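/- Let λ and μ be partitions and let k be an integer with k ≥ |λ| + |μ|. Then, in the field of fractions of ℚ[x_1,…,x_k]: sp_λ(x_1,…,x_k) · sp_μ(x_1,…,x_k) = Σ_ν (Σ_{σ,α,β} c^λ_{σα} c^μ_{σβ} c^ν_{αβ}) sp_ν(x_1,…,x_k), where ν runs over all partitions with |ν| ≤ |λ| + |μ| (so automatically ℓ(ν) ≤ k) and σ, α, β run over all partitions (only finitely many terms are nonzero). This is the stable form of the Newell–Littlewood tensor product rule ⟨λ⟩·⟨μ⟩ = Σ_σ ⟨(λ/σ)·(μ/σ)⟩ for the symplectic group. -/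

import Mathlib

open MvPolynomial
open scoped Classical

/-- A partition: a weakly decreasing sequence of non-negative integers
with finitely many nonzero parts (indexed from 0). -/
structure Partn where
  parts : ℕ → ℕ
  antitone : ∀ i j, i ≤ j → parts j ≤ parts i
  eventually_zero : ∃ N, ∀ i, N ≤ i → parts i = 0

namespace Partn

/-- The weight `|λ|` of a partition: the sum of its parts. -/
noncomputable def weight (p : Partn) : ℕ := ∑ᶠ i, p.parts i

/-- `ℓ(λ) ≤ n`: all parts from index `n` on vanish. -/
def LengthLE (p : Partn) (n : ℕ) : Prop := ∀ i, n ≤ i → p.parts i = 0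

/-- The parts of the conjugate partition `λ'`:
`λ'_i` is the number of indices `j` with `λ_j > i`. -/
noncomputable def conjParts (p : Partn) (i : ℕ) : ℕ := Nat.card {j : ℕ // i < p.parts j}

end Partn

/-- The alternant `det(x_i^{l_j + n - j})_{1 ≤ i,j ≤ n}` (indices taken 0-based). -/
noncomputable def alternant (n : ℕ) (l : ℕ → ℕ) : MvPolynomial (Fin n) ℤ :=
  (Matrix.of fun i j : Fin n =>
    (X i : MvPolynomial (Fin n) ℤ) ^ (l (j : ℕ) + (n - 1 - (j : ℕ)))).det

/-- The Vandermonde determinant `det(x_i^{n-j})_{1 ≤ i,j ≤ n}` (0-based). -/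
noncomputable def vandermondeP (n : ℕ) : MvPolynomial (Fin n) ℤ :=
  (Matrix.of fun i j : Fin n =>
    (X i : MvPolynomial (Fin n) ℤ) ^ (n - 1 - (j : ℕ))).det

/-- The Schur polynomial `s_l(x_1,…,x_n)`: the (unique, since `ℤ[x]` is a domain
and the Vandermonde determinant is nonzero) quotient of the alternant by the
Vandermonde determinant, when the latter divides the former. -/
noncomputable def schur (n : ℕ) (l : ℕ → ℕ) : MvPolynomial (Fin n) ℤ :=
  if h : ∃ q : MvPolynomial (Fin n) ℤ, q * vandermondeP n = alternant n l then h.choose else 0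

/-- The Littlewood–Richardson coefficient `c^ν_{λμ}`: the coefficient of `s_ν` in the
Schur-basis expansion of `s_λ · s_μ` in `|λ| + |μ|` variables, extracted as the
coefficient of the dominant monomial `x^{ν+ρ}` in `s_λ · s_μ · (Vandermonde)`.
It is zero unless `|ν| = |λ| + |μ|`. -/
noncomputable def lrCoeff (l m ν : Partn) : ℤ :=
  if ν.weight = l.weight + m.weight then
    MvPolynomial.coeff
      (Finsupp.equivFunOnFinite.symm fun j : Fin (l.weight + m.weight) =>
        ν.parts (j : ℕ) + (l.weight + m.weight - 1 - (j : ℕ)))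
      (schur (l.weight + m.weight) l.parts * schur (l.weight + m.weight) m.parts *
        vandermondeP (l.weight + m.weight))
  else 0

/-- The field of fractions of `ℚ[x_1,…,x_k]`. -/
abbrev RatFn (k : ℕ) := FractionRing (MvPolynomial (Fin k) ℚ)

/-- The image of the variable `x_i` in the field of fractions. -/
noncomputable def xv (k : ℕ) (i : Fin k) : RatFn k :=
  algebraMap (MvPolynomial (Fin k) ℚ) (RatFn k) (X i)

/-- The symplectic character `sp_λ(x_1,…,x_k)`:
`det(x_i^{λ_j+k−j+1} − x_i^{−(λ_j+k−j+1)}) / det(x_i^{k−j+1} − x_i^{−(k−j+1)})`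
(1-based `j`; below `j` is 0-based so the exponents are `λ_j + (k − j)`). -/
noncomputable def spChar (k : ℕ) (l : ℕ → ℕ) : RatFn k :=
  (Matrix.of fun i j : Fin k =>
      xv k i ^ ((l (j : ℕ) + (k - (j : ℕ)) : ℕ) : ℤ) -
        xv k i ^ (-((l (j : ℕ) + (k - (j : ℕ)) : ℕ) : ℤ))).det /
  (Matrix.of fun i j : Fin k =>
      xv k i ^ (((k - (j : ℕ) : ℕ)) : ℤ) -
        xv k i ^ (-((k - (j : ℕ) : ℕ) : ℤ))).det

/-- The odd orthogonal character `so_λ(z_1,…,z_k)`: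
`det(z_i^{2(λ_j+k−j)+1} − z_i^{−(2(λ_j+k−j)+1)}) / det(z_i^{2(k−j)+1} − z_i^{−(2(k−j)+1)})`
(1-based `j`; below `j` is 0-based so the exponents are `2(λ_j + (k−1−j)) + 1`). -/
noncomputable def soChar (k : ℕ) (l : ℕ → ℕ) : RatFn k :=
  (Matrix.of fun i j : Fin k =>
      xv k i ^ ((2 * (l (j : ℕ) + (k - 1 - (j : ℕ))) + 1 : ℕ) : ℤ) -
        xv k i ^ (-((2 * (l (j : ℕ) + (k - 1 - (j : ℕ))) + 1 : ℕ) : ℤ))).det /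
  (Matrix.of fun i j : Fin k =>
      xv k i ^ ((2 * (k - 1 - (j : ℕ)) + 1 : ℕ) : ℤ) -
        xv k i ^ (-((2 * (k - 1 - (j : ℕ)) + 1 : ℕ) : ℤ))).det

/-- The list of values `x_1,…,x_k,x_1^{−1},…,x_k^{−1}` at which Schur polynomials
in `2k` variables are evaluated for `Sp(2k)`. -/
noncomputable def spEval (k : ℕ) : Fin (2 * k) → RatFn k := fun i =>
  if h : (i : ℕ) < k then xv k ⟨i, h⟩
  else (xv k ⟨(i : ℕ) - k, by have := i.isLt; omega⟩)⁻¹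

/-- The list of values `z_1²,…,z_k²,z_1^{−2},…,z_k^{−2},1` at which Schur polynomials
in `2k+1` variables are evaluated for `SO(2k+1)`. -/
noncomputable def soEval (k : ℕ) : Fin (2 * k + 1) → RatFn k := fun i =>
  if h : (i : ℕ) < k then xv k ⟨i, h⟩ ^ 2
  else if h2 : (i : ℕ) < 2 * k then ((xv k ⟨(i : ℕ) - k, by omega⟩)⁻¹) ^ 2
  else 1


namespace NL

/-- Turn an exponent vector into a finitely supported function. -/
noncomputable abbrev fs {n : ℕ} (e : Fin n → ℕ) : Fin n →₀ ℕ := Finsupp.equivFunOnFinite.symm e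

section basic
variable {A : Type*} [CommRing A]

/-- The product of one-variable power series in separate variables. -/
noncomputable def PRfun {n : ℕ} (f : Fin n → PowerSeries A) : MvPowerSeries (Fin n) A :=
  fun e => ∏ i, PowerSeries.coeff (e i) (f i)

lemma coeff_PRfun {n : ℕ} (f : Fin n → PowerSeries A) (e : Fin n →₀ ℕ) :
    MvPowerSeries.coeff e (PRfun f) = ∏ i, PowerSeries.coeff (e i) (f i) := rfl

lemma PRfun_mul {n : ℕ} (f g : Fin n → PowerSeries A) :
    PRfun (f * g) = PRfun f * PRfun g := by
  ext e
  rw [MvPowerSeries.coeff_mul, coeff_PRfun]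
  simp only [Pi.mul_apply, PowerSeries.coeff_mul, coeff_PRfun]
  rw [Finset.prod_univ_sum]
  refine Finset.sum_nbij' (fun x => (fs (fun i => (x i).1), fs (fun i => (x i).2)))
    (fun p i => (p.1 i, p.2 i)) ?_ ?_ ?_ ?_ ?_
  · intro x hx
    rw [Fintype.mem_piFinset] at hx
    rw [Finset.HasAntidiagonal.mem_antidiagonal]
    ext i
    simpa using hx i
  · intro p hp
    rw [Finset.HasAntidiagonal.mem_antidiagonal] at hp
    rw [Fintype.mem_piFinset]
    intro i
    rw [Finset.HasAntidiagonal.mem_antidiagonal, ← hp]; rfl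
  · intro x _; rfl
  · intro p _; ext i <;> rfl
  · intro x _
    rw [← Finset.prod_mul_distrib]; rfl

lemma PRfun_one {n : ℕ} : PRfun (1 : Fin n → PowerSeries A) = 1 := by
  ext e
  rw [coeff_PRfun, MvPowerSeries.coeff_one]
  simp only [Pi.one_apply, PowerSeries.coeff_one]
  split_ifs with h
  · subst h; simp
  · obtain ⟨i, hi⟩ : ∃ i, e i ≠ 0 := by
      by_contra hc; push Not at hc; exact h (Finsupp.ext hc)
    exact Finset.prod_eq_zero (Finset.mem_univ i) (by simp [hi])

noncomputable def PR (n : ℕ) (A : Type*) [CommRing A] :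
    (Fin n → PowerSeries A) →* MvPowerSeries (Fin n) A where
  toFun := PRfun
  map_one' := PRfun_one
  map_mul' := PRfun_mul

lemma coeff_PR {n : ℕ} (f : Fin n → PowerSeries A) (e : Fin n →₀ ℕ) :
    MvPowerSeries.coeff e (PR n A f) = ∏ i, PowerSeries.coeff (e i) (f i) := rfl

/-- A one-variable series in the `j`-th variable. -/
noncomputable def io {n : ℕ} (j : Fin n) : PowerSeries A →+* MvPowerSeries (Fin n) A where
  toFun f := PR n A (Pi.mulSingle j f)
  map_one' := by rw [Pi.mulSingle_one, map_one]
  map_mul' f g := by rw [Pi.mulSingle_mul, map_mul]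
  map_zero' := by
    ext e
    rw [coeff_PR]
    exact Finset.prod_eq_zero (Finset.mem_univ j) (by simp)
  map_add' f g := by
    ext e
    rw [map_add, coeff_PR, coeff_PR, coeff_PR, ← Finset.mul_prod_erase _ _ (Finset.mem_univ j),
      ← Finset.mul_prod_erase _ _ (Finset.mem_univ j),
      ← Finset.mul_prod_erase _ _ (Finset.mem_univ j)]
    simp only [Pi.mulSingle_eq_same, map_add, add_mul]
    congr 1 <;> congr 1 <;> refine Finset.prod_congr rfl fun i hi => ?_ <;>
      rw [Pi.mulSingle_eq_of_ne (Finset.ne_of_mem_erase hi),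
        Pi.mulSingle_eq_of_ne (Finset.ne_of_mem_erase hi)]

lemma PR_eq {n : ℕ} (f : Fin n → PowerSeries A) : PR n A f = ∏ j, io j (f j) := by
  conv_lhs => rw [← Finset.univ_prod_mulSingle f]
  rw [map_prod]; rfl

lemma io_coeff {n : ℕ} (j : Fin n) (f : PowerSeries A) (e : Fin n →₀ ℕ) :
    MvPowerSeries.coeff e (io j f) =
      ∏ i, PowerSeries.coeff (e i) ((Pi.mulSingle j f : Fin n → PowerSeries A) i) := rfl

lemma io_C {n : ℕ} (j : Fin n) (a : A) : io j (PowerSeries.C a) = MvPowerSeries.C a := by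
  ext e
  rw [io_coeff]
  rw [MvPowerSeries.coeff_C]
  split_ifs with h
  · subst h
    rw [Finset.prod_eq_single j]
    · simp
    · intro b _ hb; simp [Pi.mulSingle_eq_of_ne hb]
    · simp
  · obtain ⟨i, hi⟩ : ∃ i, e i ≠ 0 := by
      by_contra hc; push Not at hc; exact h (Finsupp.ext hc)
    refine Finset.prod_eq_zero (Finset.mem_univ i) ?_
    by_cases hij : i = j
    · subst hij; simp [PowerSeries.coeff_C, hi]
    · simp [Pi.mulSingle_eq_of_ne hij, PowerSeries.coeff_one, hi]

lemma io_X {n : ℕ} (j : Fin n) : io j (PowerSeries.X : PowerSeries A) = MvPowerSeries.X j := by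
  ext e
  rw [io_coeff]
  rw [MvPowerSeries.coeff_X]
  split_ifs with h
  · subst h
    refine Finset.prod_eq_one fun i _ => ?_
    by_cases hij : i = j
    · subst hij; simp
    · simp [Pi.mulSingle_eq_of_ne hij, PowerSeries.coeff_one, Finsupp.single_apply, Ne.symm hij]
  · obtain ⟨i, hi⟩ : ∃ i, e i ≠ Finsupp.single j 1 i := by
      by_contra hc; push Not at hc; exact h (Finsupp.ext hc)
    refine Finset.prod_eq_zero (Finset.mem_univ i) ?_
    by_cases hij : i = j
    · subst hij
      simp only [Finsupp.single_eq_same] at hi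
      simp [PowerSeries.coeff_X, hi]
    · rw [Finsupp.single_eq_of_ne hij] at hi
      simp [Pi.mulSingle_eq_of_ne hij, PowerSeries.coeff_one, hi]

/-- Splitting the variables in two blocks. -/
noncomputable def app {a b : ℕ} (e : Fin a →₀ ℕ) (f : Fin b →₀ ℕ) : Fin (a + b) →₀ ℕ :=
  fs (Fin.append e f)

lemma app_eq_zero {a b : ℕ} (e : Fin a →₀ ℕ) (f : Fin b →₀ ℕ) :
    app e f = 0 ↔ e = 0 ∧ f = 0 := by
  constructor
  · intro h
    constructor
    · ext i
      simpa [app] using DFunLike.congr_fun h (Fin.castAdd b i)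
    · ext i
      simpa [app] using DFunLike.congr_fun h (Fin.natAdd a i)
  · rintro ⟨rfl, rfl⟩
    ext i
    refine Fin.addCases (fun i => ?_) (fun i => ?_) i <;> simp [app]

/-- A power series with prescribed coefficients. -/
noncomputable def mkS {σ : Type*} {A : Type*} [CommRing A] (f : (σ →₀ ℕ) → A) :
    MvPowerSeries σ A := f

lemma coeff_mkS {σ : Type*} (f : (σ →₀ ℕ) → A) (e : σ →₀ ℕ) :
    MvPowerSeries.coeff e (mkS f) = f e := rfl

noncomputable def Phfun {a b : ℕ} (F : MvPowerSeries (Fin (a + b)) A) :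
    MvPowerSeries (Fin a) (MvPowerSeries (Fin b) A) :=
  mkS fun e => mkS fun f => MvPowerSeries.coeff (app e f) F

lemma coeff_Phfun {a b : ℕ} (F : MvPowerSeries (Fin (a + b)) A)
    (e : Fin a →₀ ℕ) (f : Fin b →₀ ℕ) :
    MvPowerSeries.coeff f (MvPowerSeries.coeff e (Phfun F)) =
      MvPowerSeries.coeff (app e f) F := rfl

/-- Split the variables of a power series in two blocks. -/
noncomputable def Ph (a b : ℕ) (A : Type*) [CommRing A] :
    MvPowerSeries (Fin (a + b)) A →+* MvPowerSeries (Fin a) (MvPowerSeries (Fin b) A) where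
  toFun F := Phfun F
  map_one' := by
    ext e f
    rw [coeff_Phfun, MvPowerSeries.coeff_one, MvPowerSeries.coeff_one]
    simp only [app_eq_zero]
    by_cases he : e = 0 <;> by_cases hf : f = 0 <;> simp [he, hf, MvPowerSeries.coeff_one]
  map_mul' F G := by
    ext e f
    rw [coeff_Phfun, MvPowerSeries.coeff_mul, MvPowerSeries.coeff_mul, map_sum]
    simp only [MvPowerSeries.coeff_mul, coeff_Phfun]
    rw [← Finset.sum_product']
    symm
    refine Finset.sum_nbij' (fun x => (app x.1.1 x.2.1, app x.1.2 x.2.2))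
      (fun p => ((fs fun i => p.1 (Fin.castAdd b i), fs fun i => p.2 (Fin.castAdd b i)),
        (fs fun i => p.1 (Fin.natAdd a i), fs fun i => p.2 (Fin.natAdd a i)))) ?_ ?_ ?_ ?_ ?_
    · rintro ⟨⟨x1, x2⟩, ⟨y1, y2⟩⟩ hx
      simp only [Finset.mem_product, Finset.HasAntidiagonal.mem_antidiagonal] at hx ⊢
      rw [← hx.1, ← hx.2]
      ext i
      refine Fin.addCases (fun i => ?_) (fun i => ?_) i <;> simp [app]
    · rintro ⟨p1, p2⟩ hp
      simp only [Finset.mem_product, Finset.HasAntidiagonal.mem_antidiagonal] at hp ⊢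
      constructor
      · ext i
        simpa [app] using DFunLike.congr_fun hp (Fin.castAdd b i)
      · ext i
        simpa [app] using DFunLike.congr_fun hp (Fin.natAdd a i)
    · rintro ⟨⟨x1, x2⟩, ⟨y1, y2⟩⟩ hx
      ext i <;> simp [app]
    · rintro ⟨p1, p2⟩ hp
      ext i <;> refine Fin.addCases (fun i => ?_) (fun i => ?_) i <;> simp [app]
    · rintro ⟨⟨x1, x2⟩, ⟨y1, y2⟩⟩ hx
      rfl
  map_zero' := rfl
  map_add' F G := rfl

lemma coeff_Ph {a b : ℕ} (F : MvPowerSeries (Fin (a + b)) A) (e : Fin a →₀ ℕ) (f : Fin b →₀ ℕ) :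
    MvPowerSeries.coeff f (MvPowerSeries.coeff e (Ph a b A F)) =
      MvPowerSeries.coeff (app e f) F := rfl

lemma Ph_surj {a b : ℕ} (G : MvPowerSeries (Fin a) (MvPowerSeries (Fin b) A)) :
    ∃ F, Ph a b A F = G := by
  refine ⟨mkS fun p => MvPowerSeries.coeff (fs fun i => p (Fin.natAdd a i))
    (MvPowerSeries.coeff (fs fun i => p (Fin.castAdd b i)) G), ?_⟩
  ext e f
  rw [coeff_Ph, coeff_mkS]
  have h1 : (fs fun i => (app e f) (Fin.natAdd a i)) = f := by ext i; simp [app]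
  have h2 : (fs fun i => (app e f) (Fin.castAdd b i)) = e := by ext i; simp [app]
  rw [h1, h2]

lemma app_eq_single_left {a b : ℕ} (e : Fin a →₀ ℕ) (f : Fin b →₀ ℕ) (i : Fin a) :
    app e f = Finsupp.single (Fin.castAdd b i) 1 ↔ e = Finsupp.single i 1 ∧ f = 0 := by
  constructor
  · intro h
    constructor
    · ext j
      simpa [app, Finsupp.single_apply] using DFunLike.congr_fun h (Fin.castAdd b j)
    · ext j
      have := DFunLike.congr_fun h (Fin.natAdd a j)
      rw [Finsupp.single_eq_of_ne (by intro h; simp [Fin.ext_iff] at h; omega)] at this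
      simpa [app] using this
  · rintro ⟨rfl, rfl⟩
    ext j
    refine Fin.addCases (fun j => ?_) (fun j => ?_) j
    · simp [app, Finsupp.single_apply]
    · rw [Finsupp.single_eq_of_ne (by intro h; simp [Fin.ext_iff] at h; omega)]
      simp [app]

lemma app_eq_single_right {a b : ℕ} (e : Fin a →₀ ℕ) (f : Fin b →₀ ℕ) (i : Fin b) :
    app e f = Finsupp.single (Fin.natAdd a i) 1 ↔ e = 0 ∧ f = Finsupp.single i 1 := by
  constructor
  · intro h
    constructor
    · ext j
      have := DFunLike.congr_fun h (Fin.castAdd b j)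
      rw [Finsupp.single_eq_of_ne (by intro h; simp [Fin.ext_iff] at h; omega)] at this
      simpa [app] using this
    · ext j
      simpa [app, Finsupp.single_apply] using DFunLike.congr_fun h (Fin.natAdd a j)
  · rintro ⟨rfl, rfl⟩
    ext j
    refine Fin.addCases (fun j => ?_) (fun j => ?_) j
    · rw [Finsupp.single_eq_of_ne (by intro h; simp [Fin.ext_iff] at h; omega)]
      simp [app]
    · simp [app, Finsupp.single_apply]

lemma Ph_X_left {a b : ℕ} (i : Fin a) :
    Ph a b A (MvPowerSeries.X (Fin.castAdd b i)) = MvPowerSeries.X i := by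
  ext e f
  rw [coeff_Ph, MvPowerSeries.coeff_X, MvPowerSeries.coeff_X]
  simp only [app_eq_single_left]
  by_cases he : e = Finsupp.single i 1 <;> by_cases hf : f = 0 <;>
    simp [he, hf, MvPowerSeries.coeff_one]

lemma Ph_X_right {a b : ℕ} (i : Fin b) :
    Ph a b A (MvPowerSeries.X (Fin.natAdd a i)) = MvPowerSeries.C (MvPowerSeries.X i) := by
  ext e f
  rw [coeff_Ph, MvPowerSeries.coeff_X, MvPowerSeries.coeff_C]
  simp only [app_eq_single_right]
  by_cases he : e = 0 <;> by_cases hf : f = Finsupp.single i 1 <;>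
    simp [he, hf, MvPowerSeries.coeff_X]

lemma Ph_C {a b : ℕ} (r : A) :
    Ph a b A (MvPowerSeries.C r) = MvPowerSeries.C (MvPowerSeries.C r) := by
  ext e f
  rw [coeff_Ph, MvPowerSeries.coeff_C, MvPowerSeries.coeff_C]
  simp only [app_eq_zero]
  by_cases he : e = 0 <;> by_cases hf : f = 0 <;>
    simp [he, hf, MvPowerSeries.coeff_C]

end basic
end NL


namespace NL

/-- product over pairs `i < j`. -/
noncomputable def pp {R : Type*} [CommRing R] {n : ℕ} (g : Fin n → Fin n → R) : R :=
  ∏ i, ∏ j, if i < j then g i j else 1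

lemma pp_split {R : Type*} [CommRing R] {a b : ℕ} (g : Fin (a + b) → Fin (a + b) → R) :
    pp g = pp (fun i j => g (Fin.castAdd b i) (Fin.castAdd b j)) *
      pp (fun i j => g (Fin.natAdd a i) (Fin.natAdd a j)) *
      ∏ i, ∏ j, g (Fin.castAdd b i) (Fin.natAdd a j) := by
  unfold pp
  rw [Fin.prod_univ_add]
  have h1 : ∀ i : Fin a, (∏ j, if Fin.castAdd b i < j then g (Fin.castAdd b i) j else 1) =
      (∏ j, if i < j then g (Fin.castAdd b i) (Fin.castAdd b j) else 1) *
      ∏ j, g (Fin.castAdd b i) (Fin.natAdd a j) := by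
    intro i
    rw [Fin.prod_univ_add]
    congr 1
    refine Finset.prod_congr rfl fun j _ => ?_
    rw [if_pos]
    rw [Fin.lt_def]; simp; omega
  have h2 : ∀ i : Fin b, (∏ j, if Fin.natAdd a i < j then g (Fin.natAdd a i) j else 1) =
      (∏ j, if i < j then g (Fin.natAdd a i) (Fin.natAdd a j) else 1) := by
    intro i
    rw [Fin.prod_univ_add]
    rw [Finset.prod_eq_one, one_mul]
    · refine Finset.prod_congr rfl fun j _ => ?_
      simp only [Fin.natAdd_lt_natAdd_iff]
    · intro j _
      rw [if_neg]
      rw [Fin.lt_def]; simp; omega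
  simp only [h1, h2]
  rw [Finset.prod_mul_distrib]
  ring

lemma map_pp {R S : Type*} [CommRing R] [CommRing S] (φ : R →+* S) {n : ℕ}
    (g : Fin n → Fin n → R) : φ (pp g) = pp (fun i j => φ (g i j)) := by
  unfold pp
  simp only [map_prod, apply_ite φ, map_one]

lemma pp_mul {R : Type*} [CommRing R] {n : ℕ} (g h : Fin n → Fin n → R) :
    pp (fun i j => g i j * h i j) = pp g * pp h := by
  unfold pp
  simp only [← Finset.prod_mul_distrib]
  refine Finset.prod_congr rfl fun i _ => Finset.prod_congr rfl fun j _ => ?_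
  split_ifs <;> simp

noncomputable def vd (n : ℕ) (A : Type*) [CommRing A] : MvPowerSeries (Fin n) A :=
  pp fun i j => MvPowerSeries.X i - MvPowerSeries.X j

noncomputable def ee (n : ℕ) {A : Type*} [CommRing A] (ε : A) : MvPowerSeries (Fin n) A :=
  pp fun i j => 1 - MvPowerSeries.C ε * MvPowerSeries.X i * MvPowerSeries.X j

noncomputable def HH (n : ℕ) {A : Type*} [CommRing A] (H : PowerSeries A) :
    MvPowerSeries (Fin n) A := PR n A (fun _ => H)

noncomputable def UU (n : ℕ) {A : Type*} [CommRing A] (ε : A) (H : PowerSeries A) :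
    MvPowerSeries (Fin n) A := ee n ε * HH n H

noncomputable def EE (n : ℕ) {A : Type*} [CommRing A] (ε : A) (H : PowerSeries A) :
    MvPowerSeries (Fin n) A := vd n A * UU n ε H

noncomputable def ex (n : ℕ) (p : Partn) : Fin n →₀ ℕ := fs fun j => p.parts j + (n - 1 - j)

lemma ex_apply (n : ℕ) (p : Partn) (j : Fin n) : ex n p j = p.parts j + (n - 1 - j) := rfl

section
variable {A B : Type*} [CommRing A] [CommRing B] (φ : A →+* B)

lemma map_vd (n : ℕ) : MvPowerSeries.map φ (vd n A) = vd n B := by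
  unfold vd; rw [map_pp]; simp

lemma map_ee (n : ℕ) (ε : A) : MvPowerSeries.map φ (ee n ε) = ee n (φ ε) := by
  unfold ee; rw [map_pp]; simp

lemma map_HH (n : ℕ) (H : PowerSeries A) :
    MvPowerSeries.map φ (HH n H) = HH n (PowerSeries.map φ H) := by
  ext e
  rw [MvPowerSeries.coeff_map, HH, coeff_PR, map_prod, HH, coeff_PR]
  simp

lemma map_UU (n : ℕ) (ε : A) (H : PowerSeries A) :
    MvPowerSeries.map φ (UU n ε H) = UU n (φ ε) (PowerSeries.map φ H) := by
  rw [UU, map_mul, map_ee, map_HH, UU]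

lemma map_EE (n : ℕ) (ε : A) (H : PowerSeries A) :
    MvPowerSeries.map φ (EE n ε H) = EE n (φ ε) (PowerSeries.map φ H) := by
  rw [EE, map_mul, map_UU, map_vd, EE]

lemma coeff_EE_map (n : ℕ) (ε : A) (H : PowerSeries A) (e : Fin n →₀ ℕ) :
    MvPowerSeries.coeff e (EE n (φ ε) (PowerSeries.map φ H)) =
      φ (MvPowerSeries.coeff e (EE n ε H)) := by
  rw [← map_EE, MvPowerSeries.coeff_map]

lemma Ph_vd (a b : ℕ) : Ph a b A (vd (a + b) A) =
    vd a (MvPowerSeries (Fin b) A) * MvPowerSeries.C (vd b A) *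
      ∏ i, ∏ j, (MvPowerSeries.X i - MvPowerSeries.C (MvPowerSeries.X j)) := by
  unfold vd
  rw [map_pp, pp_split]
  rw [map_pp]
  simp only [map_sub, Ph_X_left, Ph_X_right]

lemma Ph_ee (a b : ℕ) (ε : A) : Ph a b A (ee (a + b) ε) =
    ee a (MvPowerSeries.C ε : MvPowerSeries (Fin b) A) * MvPowerSeries.C (ee b ε) *
      ∏ i, ∏ j, (1 - MvPowerSeries.C (MvPowerSeries.C ε) * MvPowerSeries.X i *
        MvPowerSeries.C (MvPowerSeries.X j)) := by
  unfold ee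
  rw [map_pp, pp_split]
  rw [map_pp]
  simp only [map_sub, Ph_X_left, Ph_X_right, map_mul, Ph_C, map_one]

lemma Ph_HH (a b : ℕ) (H : PowerSeries A) : Ph a b A (HH (a + b) H) =
    HH a (PowerSeries.map (MvPowerSeries.C (σ := Fin b)) H) * MvPowerSeries.C (HH b H) := by
  ext e f
  rw [coeff_Ph, HH, coeff_PR, MvPowerSeries.coeff_mul_C, HH, coeff_PR]
  simp only [PowerSeries.coeff_map]
  rw [← map_prod, MvPowerSeries.coeff_C_mul, HH, coeff_PR, Fin.prod_univ_add]
  simp [app]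

lemma ex_succ (n : ℕ) (p : Partn) (hp : p.parts n = 0) :
    ex (n + 1) p = app (ex n p + fs fun _ => 1) (0 : Fin 1 →₀ ℕ) := by
  ext i
  refine Fin.addCases (fun i => ?_) (fun i => ?_) i
  · simp [app, ex]; omega
  · simp [app, ex, hp]

lemma prod_X (n : ℕ) : (∏ i, MvPowerSeries.X i : MvPowerSeries (Fin n) A) =
    MvPowerSeries.monomial (fs fun _ => 1) 1 := by
  simp only [MvPowerSeries.X]
  rw [MvPowerSeries.prod_monomial]
  have h : (∑ i, Finsupp.single i 1 : Fin n →₀ ℕ) = fs fun _ => 1 := by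
    ext i; simp [Finsupp.single_apply]
  rw [h, Finset.prod_const_one]

lemma stab_succ (n : ℕ) (ε : A) (H : PowerSeries A) (hH : PowerSeries.constantCoeff H = 1)
    (p : Partn) (hp : p.parts n = 0) :
    MvPowerSeries.coeff (ex (n + 1) p) (EE (n + 1) ε H) =
      MvPowerSeries.coeff (ex n p) (EE n ε H) := by
  rw [ex_succ n p hp, ← coeff_Ph, MvPowerSeries.coeff_zero_eq_constantCoeff_apply,
    ← MvPowerSeries.coeff_map]
  have h : MvPowerSeries.map MvPowerSeries.constantCoeff (Ph n 1 A (EE (n + 1) ε H)) =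
      (∏ i, MvPowerSeries.X i) * EE n ε H := by
    rw [EE, UU, map_mul, map_mul, map_mul, Ph_vd, Ph_ee, Ph_HH]
    simp only [map_mul, map_vd, map_ee, map_HH, map_prod, map_sub, map_one, MvPowerSeries.map_C,
      MvPowerSeries.map_X, MvPowerSeries.constantCoeff_C, MvPowerSeries.constantCoeff_X]
    have h1 : MvPowerSeries.constantCoeff (vd 1 A) = 1 := by simp [vd, pp]
    have h2 : MvPowerSeries.constantCoeff (ee 1 ε) = 1 := by simp [ee, pp]
    have h3 : MvPowerSeries.constantCoeff (HH 1 H) = 1 := by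
      rw [← MvPowerSeries.coeff_zero_eq_constantCoeff_apply, HH, coeff_PR]; simp [hH]
    have h4 : PowerSeries.map MvPowerSeries.constantCoeff
      (PowerSeries.map (MvPowerSeries.C (σ := Fin 1)) H) = H := by
      ext i; simp
    rw [h1, h2, h3, h4]
    simp [EE, UU]; ring
  rw [h, prod_X, add_comm, MvPowerSeries.coeff_add_monomial_mul, one_mul]

lemma stab (n d : ℕ) (ε : A) (H : PowerSeries A) (hH : PowerSeries.constantCoeff H = 1)
    (p : Partn) (hp : p.LengthLE n) :
    MvPowerSeries.coeff (ex (n + d) p) (EE (n + d) ε H) =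
      MvPowerSeries.coeff (ex n p) (EE n ε H) := by
  induction d with
  | zero => rfl
  | succ d ih => rw [← ih, ← add_assoc, stab_succ _ _ _ hH _ (hp _ (by omega))]

lemma stab_le {n m : ℕ} (hnm : n ≤ m) (ε : A) (H : PowerSeries A)
    (hH : PowerSeries.constantCoeff H = 1)
    (p : Partn) (hp : p.LengthLE n) :
    MvPowerSeries.coeff (ex m p) (EE m ε H) =
      MvPowerSeries.coeff (ex n p) (EE n ε H) := by
  obtain ⟨d, rfl⟩ := Nat.exists_eq_add_of_le hnm
  exact stab n d ε H hH p hp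

def p0 : Partn := ⟨fun _ => 0, fun _ _ _ => le_rfl, 0, fun _ _ => rfl⟩

lemma coeff_EE_zero (n : ℕ) (ε : A) (H : PowerSeries A)
    (hH : PowerSeries.constantCoeff H = 1) :
    MvPowerSeries.coeff (ex n p0) (EE n ε H) = 1 := by
  rw [stab_le (Nat.zero_le n) ε H hH p0 (fun _ _ => rfl)]
  have : ex 0 p0 = 0 := by ext i; exact i.elim0
  rw [this, MvPowerSeries.coeff_zero_eq_constantCoeff_apply]
  have : HH 0 H = 1 := by
    rw [HH, PR_eq]; simp
  simp [EE, UU, vd, ee, pp, this]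

end
end NL


namespace NL

section
variable {A : Type*} [CommRing A]

lemma pp_eq {R : Type*} [CommRing R] {n : ℕ} (g : Fin n → Fin n → R) :
    pp g = ∏ i, ∏ j ∈ Finset.Ioi i, g i j := by
  unfold pp
  refine Finset.prod_congr rfl fun i _ => ?_
  rw [← Finset.filter_lt_eq_Ioi, Finset.prod_filter]

lemma coeff_det_io {n : ℕ} (q : Fin n → PowerSeries A) (e : Fin n →₀ ℕ) :
    MvPowerSeries.coeff e (Matrix.of fun i j : Fin n => io j (q i)).det =
      (Matrix.of fun i j : Fin n => PowerSeries.coeff (e j) (q i)).det := by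
  rw [Matrix.det_apply', Matrix.det_apply', map_sum]
  refine Finset.sum_congr rfl fun σ _ => ?_
  have h : (((Equiv.Perm.sign σ : ℤˣ) : ℤ) : MvPowerSeries (Fin n) A) =
      MvPowerSeries.C ((((Equiv.Perm.sign σ : ℤˣ) : ℤ) : A)) := by simp
  rw [h, MvPowerSeries.coeff_C_mul]
  simp only [Matrix.of_apply]
  rw [← PR_eq (fun j => q (σ j)), coeff_PR]

/-- The rows of the projective Vandermonde matrix. -/
noncomputable def qq {n : ℕ} (ε : A) (i : Fin n) : PowerSeries A :=
  (1 + PowerSeries.C ε * PowerSeries.X ^ 2) ^ (i : ℕ) * PowerSeries.X ^ (i.rev : ℕ)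

lemma vd_mul_ee (n : ℕ) (ε : A) : vd n A * ee n ε =
    (Matrix.of fun i j : Fin n => io j (qq ε i)).det := by
  have h := Matrix.det_projVandermonde
    (fun j : Fin n => io j (1 + PowerSeries.C ε * PowerSeries.X ^ 2 : PowerSeries A))
    (fun j : Fin n => io j (PowerSeries.X : PowerSeries A))
  rw [← pp_eq] at h
  rw [← Matrix.det_transpose] at h
  have h2 : (Matrix.of fun i j : Fin n => io j (qq ε i)) =
      (Matrix.projVandermonde (fun j : Fin n =>
        io j (1 + PowerSeries.C ε * PowerSeries.X ^ 2 : PowerSeries A))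
        (fun j : Fin n => io j (PowerSeries.X : PowerSeries A))).transpose := by
    ext1 i j
    rw [Matrix.transpose_apply, Matrix.projVandermonde_apply, Matrix.of_apply, qq, map_mul,
      map_pow, map_pow]
  rw [h2, h, vd, ee, ← pp_mul]
  congr 1
  funext i j
  simp only [map_add, map_one, map_mul, map_pow, io_C, io_X]
  ring

lemma EE_eq_det (n : ℕ) (ε : A) (H : PowerSeries A) :
    EE n ε H = (Matrix.of fun i j : Fin n => io j (qq ε i * H)).det := by
  rw [EE, UU, ← mul_assoc, vd_mul_ee, HH, PR_eq]
  rw [mul_comm, ← Matrix.det_mul_row]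
  congr 1
  ext1 i j
  simp [mul_comm]

end

section
variable {F : Type*} [Field F]

lemma aux1 {K : Type*} [Field K] (v w : K) (hw : w ≠ 0) (i j : ℕ) :
    w ^ j * w ^ i * (v ^ i / w ^ i) = v ^ i * w ^ j := by field_simp

lemma aux2 {K : Type*} [Field K] (c v x w : K) (hw : w ≠ 0) :
    c * (v / w - x) * w = c * (v - x * w) := by field_simp

lemma lagr {n : ℕ} (ε : F) (ξ : Fin n → F) (hξ : Function.Injective ξ) (i : Fin n) :
    ∃ M : Fin n → F, (qq ε i : PowerSeries F) = ∑ a, PowerSeries.C (M a) *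
      ∏ b ∈ Finset.univ.erase a, (1 + PowerSeries.C ε * PowerSeries.X ^ 2 -
        PowerSeries.C (ξ b) * PowerSeries.X) := by
  refine ⟨fun a => ξ a ^ (i : ℕ) * ∏ b ∈ Finset.univ.erase a, (ξ a - ξ b)⁻¹, ?_⟩
  set v : PowerSeries F := 1 + PowerSeries.C ε * PowerSeries.X ^ 2 with hv
  let K := FractionRing (PowerSeries F)
  have hinj : Function.Injective (algebraMap (PowerSeries F) K) := IsFractionRing.injective _ _
  apply hinj
  have hX : algebraMap (PowerSeries F) K PowerSeries.X ≠ 0 := by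
    intro h
    exact PowerSeries.X_ne_zero (hinj (by rw [h, map_zero]))
  have hl := Lagrange.eq_interpolate (F := F) (s := Finset.univ) (v := ξ)
    (f := Polynomial.X ^ (i : ℕ)) hξ.injOn (by
      rw [Polynomial.degree_X_pow]; simp)
  rw [Lagrange.interpolate_apply] at hl
  set φ : F →+* K := (algebraMap (PowerSeries F) K).comp PowerSeries.C with hφ
  set w := algebraMap (PowerSeries F) K PowerSeries.X with hw
  have hl2 := congrArg (Polynomial.eval₂ φ (algebraMap _ K v / w)) hl
  rw [Polynomial.eval₂_finsetSum, Polynomial.eval₂_pow, Polynomial.eval₂_X] at hl2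
  have hl3 := congrArg (fun z => w ^ (n - 1) * z) hl2
  have e1 : w ^ (n - 1) * (algebraMap _ K v / w) ^ (i : ℕ) = algebraMap _ K (qq ε i) := by
    rw [qq, map_mul, map_pow, map_pow, ← hw, ← hv, div_pow]
    have : w ^ (n - 1) = w ^ (i.rev : ℕ) * w ^ (i : ℕ) := by
      rw [← pow_add]; congr 1; rw [Fin.val_rev]; omega
    rw [this]
    exact aux1 _ _ hX _ _
  rw [e1] at hl3
  rw [hl3, Finset.mul_sum, map_sum]
  refine Finset.sum_congr rfl fun a _ => ?_
  rw [Polynomial.eval₂_mul, Polynomial.eval₂_C, Lagrange.basis, Polynomial.eval₂_finsetProd]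
  simp only [Lagrange.basisDivisor, Polynomial.eval₂_mul, Polynomial.eval₂_C, Polynomial.eval₂_sub,
    Polynomial.eval₂_X, Polynomial.eval_pow, Polynomial.eval_X]
  have hc : w ^ (n - 1) = ∏ b ∈ Finset.univ.erase a, w := by
    rw [Finset.prod_const, Finset.card_erase_of_mem (Finset.mem_univ a)]; simp
  rw [hc, map_mul, map_prod, map_mul, map_mul, map_prod, map_prod]
  rw [mul_comm, mul_assoc, ← Finset.prod_mul_distrib]
  rw [mul_assoc, ← Finset.prod_mul_distrib]
  congr 1
  refine Finset.prod_congr rfl fun b _ => ?_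
  rw [map_sub, map_mul, ← hw]
  exact aux2 _ _ _ _ hX

/-- The bialternant-type formula. -/
lemma ratio {n : ℕ} (ε : F) (ξ : Fin n → F) (hξ : Function.Injective ξ) (G : Fin n → PowerSeries F)
    (hG : ∀ a, (1 + PowerSeries.C ε * PowerSeries.X ^ 2 -
        PowerSeries.C (ξ a) * PowerSeries.X) * G a = 1) (p : Partn) :
    MvPowerSeries.coeff (ex n p) (EE n ε (∏ a, G a)) *
      (Matrix.of fun a j : Fin n => PowerSeries.coeff (ex n p0 j) (G a)).det =
    (Matrix.of fun a j : Fin n => PowerSeries.coeff (ex n p j) (G a)).det ∧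
    (Matrix.of fun a j : Fin n => PowerSeries.coeff (ex n p0 j) (G a)).det ≠ 0 := by
  choose M hM using fun i => lagr ε ξ hξ i
  have key : ∀ i, qq ε i * ∏ a, G a = ∑ a, PowerSeries.C (M i a) * G a := by
    intro i
    rw [hM i, Finset.sum_mul]
    refine Finset.sum_congr rfl fun a _ => ?_
    rw [← Finset.mul_prod_erase _ G (Finset.mem_univ a)]
    have : (∏ b ∈ Finset.univ.erase a, (1 + PowerSeries.C ε * PowerSeries.X ^ 2 -
        PowerSeries.C (ξ b) * PowerSeries.X)) * ∏ b ∈ Finset.univ.erase a, G b = 1 := by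
      rw [← Finset.prod_mul_distrib]
      exact Finset.prod_eq_one fun b _ => hG b
    linear_combination (PowerSeries.C (M i a) * G a) * this
  have hdet : ∀ e : Fin n →₀ ℕ, MvPowerSeries.coeff e (EE n ε (∏ a, G a)) =
      (Matrix.of M).det * (Matrix.of fun a j : Fin n => PowerSeries.coeff (e j) (G a)).det := by
    intro e
    rw [EE_eq_det, coeff_det_io, ← Matrix.det_mul]
    congr 1
    ext1 i j
    rw [Matrix.mul_apply]
    simp [key]
  have hcc : PowerSeries.constantCoeff (∏ a, G a) = 1 := by
    rw [map_prod]
    refine Finset.prod_eq_one fun a _ => ?_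
    have := congrArg PowerSeries.constantCoeff (hG a)
    simpa using this
  have h0 := coeff_EE_zero n ε (∏ a, G a) hcc
  rw [hdet] at h0
  refine ⟨?_, fun h => by rw [h, mul_zero] at h0; exact zero_ne_one h0⟩
  rw [hdet]
  linear_combination (Matrix.of fun a j : Fin n => PowerSeries.coeff (ex n p j) (G a)).det * h0

end
end NL


namespace NL

/-- geometric series -/
noncomputable def geo {A : Type*} [CommRing A] (t : A) : PowerSeries A := PowerSeries.mk fun m => t ^ m

lemma geo_mul {A : Type*} [CommRing A] (t : A) :
    (1 - PowerSeries.C t * PowerSeries.X) * geo t = 1 := by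
  ext m
  cases m with
  | zero => simp [geo, sub_mul, mul_assoc]
  | succ m =>
    rw [sub_mul, one_mul, mul_assoc, map_sub, PowerSeries.coeff_C_mul, PowerSeries.coeff_succ_X_mul,
      geo, PowerSeries.coeff_mk, PowerSeries.coeff_mk, PowerSeries.coeff_one, if_neg (by omega)]
    ring

lemma map_geo {A B : Type*} [CommRing A] [CommRing B] (φ : A →+* B) (t : A) :
    PowerSeries.map φ (geo t) = geo (φ t) := by
  ext m; simp [geo]

/-- The complete symmetric generating series. -/
noncomputable def Hg {A : Type*} [CommRing A] {N : ℕ} (t : Fin N → A) : PowerSeries A :=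
  ∏ a, geo (t a)

lemma map_Hg {A B : Type*} [CommRing A] [CommRing B] (φ : A →+* B) {N : ℕ} (t : Fin N → A) :
    PowerSeries.map φ (Hg t) = Hg (fun a => φ (t a)) := by
  simp [Hg, map_prod, map_geo]

lemma cc_Hg {A : Type*} [CommRing A] {N : ℕ} (t : Fin N → A) :
    PowerSeries.constantCoeff (Hg t) = 1 := by
  rw [Hg, map_prod]
  refine Finset.prod_eq_one fun a _ => ?_
  rw [← PowerSeries.coeff_zero_eq_constantCoeff_apply]; simp [geo]

abbrev ZP (N : ℕ) := MvPolynomial (Fin N) ℤ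

noncomputable abbrev Ht (N : ℕ) : PowerSeries (ZP N) := Hg (fun a => (X a : ZP N))

lemma schur_aux (N : ℕ) (p : Partn) :
    MvPowerSeries.coeff (ex N p) (EE N 0 (Ht N)) * vandermondeP N = alternant N p.parts ∧
    vandermondeP N ≠ 0 := by
  let K := FractionRing (ZP N)
  set φ : ZP N →+* K := algebraMap (ZP N) K with hφ
  have hinj : Function.Injective φ := IsFractionRing.injective _ _
  have hr := ratio (F := K) (n := N) 0 (fun a => φ (X a))
    (hinj.comp (MvPolynomial.X_injective)) (fun a => geo (φ (X a))) (by
      intro a; rw [map_zero, zero_mul, add_zero]; exact geo_mul _) p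
  have hH : PowerSeries.map φ (Ht N) = ∏ a, geo (φ (X a)) := map_Hg φ _
  have h1 := coeff_EE_map φ N 0 (Ht N) (ex N p)
  rw [hH, map_zero] at h1
  rw [h1] at hr
  have hV : φ (vandermondeP N) =
      (Matrix.of fun a j : Fin N => PowerSeries.coeff (ex N p0 j) (geo (φ (X a)))).det := by
    rw [vandermondeP, RingHom.map_det]
    congr 1
    ext1 i j
    simp [geo, ex, p0]
  have hA : φ (alternant N p.parts) =
      (Matrix.of fun a j : Fin N => PowerSeries.coeff (ex N p j) (geo (φ (X a)))).det := by
    rw [alternant, RingHom.map_det]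
    congr 1
    ext1 i j
    simp [geo, ex]
  rw [← hV, ← hA, ← map_mul] at hr
  exact ⟨hinj hr.1, fun h => hr.2 (by rw [h, map_zero])⟩

lemma vandermondeP_ne (N : ℕ) : vandermondeP N ≠ 0 := (schur_aux N p0).2

lemma schur_eq (N : ℕ) (p : Partn) :
    schur N p.parts = MvPowerSeries.coeff (ex N p) (EE N 0 (Ht N)) := by
  have h := (schur_aux N p).1
  have hex : ∃ q : MvPolynomial (Fin N) ℤ, q * vandermondeP N = alternant N p.parts := ⟨_, h⟩
  rw [schur, dif_pos hex]
  exact mul_right_cancel₀ (vandermondeP_ne N) (hex.choose_spec.trans h.symm)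

lemma schur_mul (N : ℕ) (p : Partn) :
    schur N p.parts * vandermondeP N = alternant N p.parts := by
  rw [schur_eq]; exact (schur_aux N p).1

/-- specialization of Schur -/
lemma schur_spec {A : Type*} [CommRing A] {N : ℕ} (t : Fin N → A) (p : Partn) (n : ℕ) (hn : N ≤ n)
    (hp : p.LengthLE N) :
    MvPowerSeries.coeff (ex n p) (EE n 0 (Hg t)) =
      MvPolynomial.eval₂Hom (Int.castRingHom A) t (schur N p.parts) := by
  rw [stab_le hn 0 (Hg t) (cc_Hg t) p hp, schur_eq, ← coeff_EE_map]
  rw [map_Hg, map_zero]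
  simp

/-- Polynomials to power series. -/
noncomputable def tp (n : ℕ) (A : Type*) [CommRing A] : ZP n →+* MvPowerSeries (Fin n) A :=
  (MvPowerSeries.map (Int.castRingHom A)).comp MvPolynomial.coeToMvPowerSeries.ringHom

lemma coeff_tp {n : ℕ} {A : Type*} [CommRing A] (f : ZP n) (e : Fin n →₀ ℕ) :
    MvPowerSeries.coeff e (tp n A f) = ((MvPolynomial.coeff e f : ℤ) : A) := by
  simp [tp]

lemma tp_X {n : ℕ} {A : Type*} [CommRing A] (i : Fin n) :
    tp n A (X i) = MvPowerSeries.X i := by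
  simp [tp]

lemma map_tp {n : ℕ} {A B : Type*} [CommRing A] [CommRing B] (φ : A →+* B) (f : ZP n) :
    MvPowerSeries.map φ (tp n A f) = tp n B f := by
  ext e; simp [coeff_tp]

lemma tp_vandermondeP (n : ℕ) (A : Type*) [CommRing A] : tp n A (vandermondeP n) = vd n A := by
  have h := vd_mul_ee (A := A) n 0
  have he : ee n (0 : A) = 1 := by simp [ee, pp]
  rw [he, mul_one] at h
  rw [h, vandermondeP, RingHom.map_det, ← Matrix.det_transpose]
  congr 1
  ext1 i j
  simp only [Matrix.transpose_apply, RingHom.mapMatrix_apply, Matrix.map_apply, Matrix.of_apply, qq,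
    map_mul, map_pow, io_X, tp_X, map_add, map_one, map_zero, zero_mul, add_zero, one_pow, one_mul]
  congr 1
  rw [Fin.val_rev]; omega

lemma tp_schur_mul (N : ℕ) (A : Type*) [CommRing A] (p : Partn) :
    tp N A (schur N p.parts) * vd N A = tp N A (alternant N p.parts) := by
  rw [← schur_mul, map_mul, tp_vandermondeP]

section sp
variable {k : ℕ}

lemma xv_ne (a : Fin k) : xv k a ≠ 0 := by
  rw [xv, Ne, map_eq_zero_iff _ (IsFractionRing.injective _ _)]
  exact MvPolynomial.X_ne_zero a

lemma xv_mul_ne (a b : Fin k) : xv k a * xv k b ≠ 1 := by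
  rw [xv, xv, ← map_mul, ← map_one (algebraMap (MvPolynomial (Fin k) ℚ) (RatFn k))]
  intro h
  have h2 := IsFractionRing.injective (MvPolynomial (Fin k) ℚ) (RatFn k) h
  have := congrArg MvPolynomial.constantCoeff h2
  simp at this

lemma xv_inj : Function.Injective (xv k) :=
  (IsFractionRing.injective (MvPolynomial (Fin k) ℚ) (RatFn k)).comp MvPolynomial.X_injective

lemma xi_inj : Function.Injective (fun a : Fin k => xv k a + (xv k a)⁻¹) := by
  intro a b h
  have ha := xv_ne a
  have hb := xv_ne b
  have : (xv k a - xv k b) * (xv k a * xv k b - 1) = 0 := by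
    simp only at h
    field_simp at h
    linear_combination h
  rcases mul_eq_zero.1 this with h | h
  · exact xv_inj (sub_eq_zero.1 h)
  · exact absurd (sub_eq_zero.1 h) (xv_mul_ne a b)

lemma dx_ne (a : Fin k) : xv k a - (xv k a)⁻¹ ≠ 0 := by
  intro h
  apply xv_mul_ne a a
  have ha := xv_ne a
  rw [sub_eq_zero] at h
  nth_rewrite 1 [h]
  exact inv_mul_cancel₀ ha

/-- The symplectic one-variable series. -/
noncomputable def Gx {F : Type*} [Field F] (x : F) : PowerSeries F :=
  PowerSeries.mk fun m => (x ^ (m + 1) - (x⁻¹) ^ (m + 1)) / (x - x⁻¹)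

lemma Gx_mul {F : Type*} [Field F] (x : F) (hx : x ≠ 0) (hd : x - x⁻¹ ≠ 0) :
    (1 + PowerSeries.C 1 * PowerSeries.X ^ 2 - PowerSeries.C (x + x⁻¹) * PowerSeries.X) * Gx x = 1 := by
  have hxy : x * x⁻¹ = 1 := mul_inv_cancel₀ hx
  rw [Gx]
  generalize x⁻¹ = y at *
  have e : (1 + PowerSeries.C 1 * PowerSeries.X ^ 2 - PowerSeries.C (x + y) * PowerSeries.X) *
      (PowerSeries.mk fun m => (x ^ (m + 1) - y ^ (m + 1)) / (x - y)) =
      (PowerSeries.mk fun m => (x ^ (m + 1) - y ^ (m + 1)) / (x - y)) +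
      PowerSeries.X * (PowerSeries.X * (PowerSeries.mk fun m => (x ^ (m + 1) - y ^ (m + 1)) / (x - y)))
      - PowerSeries.C (x + y) * (PowerSeries.X *
        (PowerSeries.mk fun m => (x ^ (m + 1) - y ^ (m + 1)) / (x - y))) := by
    rw [map_one]; ring
  rw [e]
  ext m
  rw [map_sub, map_add, PowerSeries.coeff_C_mul, PowerSeries.coeff_mk]
  rcases m with _ | _ | m
  · simp [hd]
  · rw [PowerSeries.coeff_succ_X_mul, PowerSeries.coeff_succ_X_mul, PowerSeries.coeff_mk,
      PowerSeries.coeff_one, if_neg (by omega)]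
    simp
    field_simp
    ring
  · rw [PowerSeries.coeff_succ_X_mul, PowerSeries.coeff_succ_X_mul, PowerSeries.coeff_succ_X_mul,
      PowerSeries.coeff_mk,
      PowerSeries.coeff_mk, PowerSeries.coeff_one, if_neg (by omega)]
    field_simp
    linear_combination (-(x ^ (m + 1)) + y ^ (m + 1)) * hxy

noncomputable def Hx (k : ℕ) : PowerSeries (RatFn k) := ∏ a, Gx (xv k a)

lemma cc_Hx : PowerSeries.constantCoeff (Hx k) = 1 := by
  rw [Hx, map_prod]
  refine Finset.prod_eq_one fun a _ => ?_
  rw [← PowerSeries.coeff_zero_eq_constantCoeff_apply]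
  simp [Gx, dx_ne]

lemma spChar_eq (p : Partn) :
    spChar k p.parts = MvPowerSeries.coeff (ex k p) (EE k 1 (Hx k)) := by
  have hr := ratio (F := RatFn k) (n := k) 1 _ xi_inj (fun a => Gx (xv k a))
    (fun a => Gx_mul _ (xv_ne a) (dx_ne a)) p
  have hnum : ∀ q : Partn, (Matrix.of fun i j : Fin k =>
      xv k i ^ ((q.parts j + (k - j) : ℕ) : ℤ) - xv k i ^ (-((q.parts j + (k - j) : ℕ) : ℤ))).det =
      (∏ i, (xv k i - (xv k i)⁻¹)) *
        (Matrix.of fun a j : Fin k => PowerSeries.coeff (ex k q j) (Gx (xv k a))).det := by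
    intro q
    rw [← Matrix.det_mul_column]
    congr 1
    ext1 i j
    have he : q.parts j + (k - j) = ex k q j + 1 := by
      rw [ex_apply]; have := j.2; omega
    simp only [Matrix.of_apply, he, Gx, PowerSeries.coeff_mk]
    rw [mul_div_cancel₀ _ (dx_ne i), zpow_neg, zpow_natCast, inv_pow]
  have h0 : (Matrix.of fun i j : Fin k => xv k i ^ ((k - j : ℕ) : ℤ) -
      xv k i ^ (-((k - j : ℕ) : ℤ))).det = (∏ i, (xv k i - (xv k i)⁻¹)) *
        (Matrix.of fun a j : Fin k => PowerSeries.coeff (ex k p0 j) (Gx (xv k a))).det := by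
    rw [← hnum p0]
    simp only [p0, zero_add]
  have hp : (∏ i, (xv k i - (xv k i)⁻¹)) ≠ 0 := Finset.prod_ne_zero_iff.2 fun i _ => dx_ne i
  rw [spChar, h0, hnum p, mul_div_mul_left _ _ hp, ← hr.1]
  exact mul_div_cancel_right₀ _ hr.2

end sp
end NL


namespace NL

lemma Partn_ext {p q : Partn} (h : ∀ i, p.parts i = q.parts i) : p = q := by
  cases p; cases q
  congr
  funext i; exact h i

lemma weight_eq (p : Partn) (n : ℕ) (h : p.LengthLE n) : p.weight = ∑ j : Fin n, p.parts j := by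
  rw [Partn.weight, finsum_eq_sum_of_support_subset (s := Finset.range n), Finset.sum_range]
  intro i hi
  simp only [Function.mem_support] at hi
  simp only [Finset.coe_range, Set.mem_Iio]
  by_contra hc
  exact hi (h i (by omega))

lemma exists_len (p : Partn) : ∃ N, p.LengthLE N := p.eventually_zero

lemma len_weight (p : Partn) : p.LengthLE p.weight := by
  intro i hi
  by_contra hc
  obtain ⟨N, hN⟩ := exists_len p
  have hiN : i < N := by
    by_contra h; exact hc (hN i (by omega))
  have h1 : p.weight = ∑ j ∈ Finset.range N, p.parts j := by
    rw [weight_eq p N hN, Finset.sum_range]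
  have h2 : ∑ j ∈ Finset.range (i + 1), 1 ≤ ∑ j ∈ Finset.range (i + 1), p.parts j := by
    refine Finset.sum_le_sum fun j hj => ?_
    have := p.antitone j i (by simp at hj; omega)
    omega
  have h3 : ∑ j ∈ Finset.range (i + 1), p.parts j ≤ ∑ j ∈ Finset.range N, p.parts j :=
    Finset.sum_le_sum_of_subset (by intro x; simp; omega)
  simp at h2
  omega

lemma len_mono {p : Partn} {n m : ℕ} (h : p.LengthLE n) (hnm : n ≤ m) : p.LengthLE m :=
  fun i hi => h i (by omega)

lemma ex_inj {n : ℕ} {p q : Partn} (hp : p.LengthLE n) (hq : q.LengthLE n)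
    (h : ex n p = ex n q) : p = q := by
  refine Partn_ext fun i => ?_
  by_cases hi : i < n
  · have := DFunLike.congr_fun h ⟨i, hi⟩
    rw [ex_apply, ex_apply] at this
    simp at this; exact this
  · rw [hp i (by omega), hq i (by omega)]

lemma ex_strictAnti (n : ℕ) (p : Partn) : StrictAnti (ex n p) := by
  intro i j hij
  rw [ex_apply, ex_apply]
  have := p.antitone i j (by have := Fin.lt_def.1 hij; omega)
  have := Fin.lt_def.1 hij
  have := j.2
  omega

lemma finPP (n D : ℕ) : Set.Finite {p : Partn | p.LengthLE n ∧ p.weight ≤ D} := by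
  refine Set.Finite.of_finite_image (f := ex n) ?_ ?_
  · refine Set.Finite.subset (Finset.finite_toSet (Finset.Iic (fs fun _ : Fin n => D + n))) ?_
    rintro _ ⟨p, ⟨h1, h2⟩, rfl⟩
    simp only [Finset.coe_Iic, Set.mem_Iic]
    intro j
    rw [ex_apply]
    rw [weight_eq p n h1] at h2
    have := Finset.single_le_sum (f := fun j : Fin n => p.parts j) (fun _ _ => Nat.zero_le _)
      (Finset.mem_univ j)
    simp at this ⊢
    omega
  · intro p hp q hq h
    exact ex_inj hp.1 hq.1 h

/-- Partitions with at most `n` parts and weight at most `D`. -/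
noncomputable def PP (n D : ℕ) : Finset Partn := (finPP n D).toFinset

lemma mem_PP {n D : ℕ} {p : Partn} : p ∈ PP n D ↔ p.LengthLE n ∧ p.weight ≤ D := by
  simp [PP]

def tri (n : ℕ) : ℕ := ∑ j : Fin n, (n - 1 - j)

lemma degree_ex (n : ℕ) (p : Partn) (h : p.LengthLE n) :
    (ex n p).degree = p.weight + tri n := by
  rw [Finsupp.degree_eq_sum, weight_eq p n h, tri, ← Finset.sum_add_distrib]
  rfl

/-- Sorted exponent vectors come from partitions. -/
lemma exists_ex {n : ℕ} (g : Fin n → ℕ) (hg : StrictAnti g) :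
    ∃ p : Partn, p.LengthLE n ∧ ex n p = fs g := by
  have hlow : ∀ d, ∀ j : Fin n, (j : ℕ) + d + 1 = n → d ≤ g j := by
    intro d
    induction d with
    | zero => intro j _; omega
    | succ d ih =>
      intro j hj
      have h1 := ih ⟨j + 1, by omega⟩ (by simp; omega)
      have h2 : g ⟨j + 1, by omega⟩ < g j := hg (by rw [Fin.lt_def]; simp)
      omega
  refine ⟨⟨fun j => if h : j < n then g ⟨j, h⟩ - (n - 1 - j) else 0, ?_, n, ?_⟩, ?_, ?_⟩
  · have : Antitone (fun j => if h : j < n then g ⟨j, h⟩ - (n - 1 - j) else 0) := by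
      refine antitone_nat_of_succ_le fun j => ?_
      by_cases h : j + 1 < n
      · have h' : j < n := by omega
        simp only [h, h', dif_pos]
        have h2 : g ⟨j + 1, h⟩ < g ⟨j, h'⟩ := hg (by rw [Fin.lt_def]; simp)
        omega
      · simp only [h, dif_neg, not_false_eq_true]
        omega
    exact fun i j hij => this hij
  · intro i hi; simp; omega
  · intro i hi; simp; omega
  · ext j
    rw [ex_apply]
    simp only [j.2, dif_pos, Fin.eta]
    have := hlow (n - 1 - j) j (by omega)
    simp
    omega

lemma sort_ex {n : ℕ} (e : Fin n →₀ ℕ) (he : Function.Injective e) :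
    ∃ (σ : Equiv.Perm (Fin n)) (p : Partn), p.LengthLE n ∧ fs (e ∘ σ) = ex n p := by
  set f : Fin n → ℕᵒᵈ := fun i => OrderDual.toDual (e i) with hf
  have hm := Tuple.monotone_sort f
  have hs : StrictAnti (e ∘ Tuple.sort f) := by
    intro i j hij
    have h1 : e (Tuple.sort f j) ≤ e (Tuple.sort f i) := hm hij.le
    refine lt_of_le_of_ne h1 fun h => ?_
    exact hij.ne' ((Tuple.sort f).injective (he h))
  obtain ⟨p, h1, h2⟩ := exists_ex _ hs
  exact ⟨_, p, h1, h2.symm⟩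

section
variable {A : Type*} [CommRing A]

/-- Antisymmetric power series. -/
def Anti {n : ℕ} (F : MvPowerSeries (Fin n) A) : Prop :=
  (∀ (σ : Equiv.Perm (Fin n)) (e : Fin n →₀ ℕ), MvPowerSeries.coeff (fs (e ∘ σ)) F =
    (((Equiv.Perm.sign σ : ℤˣ) : ℤ) : A) * MvPowerSeries.coeff e F) ∧
  ∀ e : Fin n →₀ ℕ, ¬ Function.Injective e → MvPowerSeries.coeff e F = 0

lemma anti_det {n : ℕ} (q : Fin n → PowerSeries A) :
    Anti (Matrix.of fun i j : Fin n => io j (q i)).det := by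
  constructor
  · intro σ e
    rw [coeff_det_io, coeff_det_io, ← Matrix.det_permute']
    rfl
  · intro e he
    rw [coeff_det_io]
    simp only [Function.Injective, not_forall] at he
    obtain ⟨i, j, hij, hne⟩ := he
    exact Matrix.det_zero_of_column_eq hne (fun k => by simp [hij])

lemma anti_EE (n : ℕ) (ε : A) (H : PowerSeries A) : Anti (EE n ε H) := by
  rw [EE_eq_det]; exact anti_det _

/-- alternant as power series -/
noncomputable def al (n : ℕ) (A : Type*) [CommRing A] (p : Partn) : MvPowerSeries (Fin n) A :=
  tp n A (alternant n p.parts)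

lemma al_eq (n : ℕ) (p : Partn) : al n A p =
    (Matrix.of fun i j : Fin n => io j ((PowerSeries.X : PowerSeries A) ^ (ex n p i))).det := by
  rw [al, alternant, RingHom.map_det, ← Matrix.det_transpose]
  congr 1
  ext1 i j
  simp [tp_X, io_X, ex_apply]

lemma anti_al (n : ℕ) (p : Partn) : Anti (al n A p) := by
  rw [al_eq]; exact anti_det _

lemma al_schur (n : ℕ) (p : Partn) : tp n A (schur n p.parts) * vd n A = al n A p :=
  tp_schur_mul n A p

lemma coeff_al (n : ℕ) (p q : Partn) (hp : p.LengthLE n) (hq : q.LengthLE n) :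
    MvPowerSeries.coeff (ex n p) (al n A q) = if p = q then 1 else 0 := by
  rw [al_eq, coeff_det_io, Matrix.det_apply']
  have hz : ∀ σ : Equiv.Perm (Fin n), (σ ≠ 1 ∨ p ≠ q) →
      ∏ i, (Matrix.of fun i j : Fin n => PowerSeries.coeff (ex n p j)
        ((PowerSeries.X : PowerSeries A) ^ (ex n q i))) (σ i) i = 0 := by
    intro σ hσ
    by_contra hne
    have hall : ∀ i, ex n p i = ex n q (σ i) := by
      intro i
      by_contra hc
      apply hne
      refine Finset.prod_eq_zero (Finset.mem_univ i) ?_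
      rw [Matrix.of_apply, PowerSeries.coeff_X_pow, if_neg hc]
    have hmono : Monotone σ := by
      intro i j hij
      by_contra hlt
      push Not at hlt
      have h1 := ex_strictAnti n q hlt
      rw [← hall, ← hall] at h1
      have h2 := (ex_strictAnti n p).antitone hij
      omega
    have h1 : σ = 1 := (Equiv.Perm.monotone_iff σ).1 hmono
    subst h1
    rcases hσ with h | h
    · exact h rfl
    · exact h (ex_inj hp hq (Finsupp.ext fun i => hall i))
  split_ifs with h
  · subst h
    rw [Finset.sum_eq_single 1]
    · simp [PowerSeries.coeff_X_pow]
    · intro σ _ hσ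
      rw [hz σ (Or.inl hσ), mul_zero]
    · simp
  · refine Finset.sum_eq_zero fun σ _ => ?_
    rw [hz σ (Or.inr h), mul_zero]

lemma sign_sq {n : ℕ} (σ : Equiv.Perm (Fin n)) :
    (((Equiv.Perm.sign σ : ℤˣ) : ℤ) : A) * (((Equiv.Perm.sign σ : ℤˣ) : ℤ) : A) = 1 := by
  rcases Int.units_eq_one_or (Equiv.Perm.sign σ) with h | h <;> simp [h]

lemma anti_expand {n : ℕ} (F : MvPowerSeries (Fin n) A) (hF : Anti F) (D : ℕ)
    (e : Fin n →₀ ℕ) (he : e.degree ≤ D) :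
    MvPowerSeries.coeff e F =
      ∑ α ∈ PP n D, MvPowerSeries.coeff (ex n α) F * MvPowerSeries.coeff e (al n A α) := by
  by_cases hinj : Function.Injective e
  · obtain ⟨σ, p, hp, hσ⟩ := sort_ex e hinj
    have key : ∀ G : MvPowerSeries (Fin n) A, Anti G → MvPowerSeries.coeff e G =
        (((Equiv.Perm.sign σ : ℤˣ) : ℤ) : A) * MvPowerSeries.coeff (ex n p) G := by
      intro G hG
      rw [← hσ, hG.1, ← mul_assoc, sign_sq, one_mul]
    have hdeg : p.weight ≤ D := by
      have h1 := degree_ex n p hp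
      rw [← hσ, Finsupp.degree_eq_sum] at h1
      rw [Finsupp.degree_eq_sum] at he
      have h2 : ∑ i, (fs (e ∘ σ)) i = ∑ i, e i := Equiv.sum_comp σ e
      omega
    rw [key F hF, Finset.sum_eq_single p]
    · rw [key _ (anti_al n p), coeff_al n p p hp hp, if_pos rfl]
      ring
    · intro q hq hne
      rw [key _ (anti_al n q), coeff_al n p q hp (mem_PP.1 hq).1, if_neg hne.symm]
      ring
    · intro h
      exact absurd (mem_PP.2 ⟨hp, hdeg⟩) h
  · rw [hF.2 e hinj]
    symm
    refine Finset.sum_eq_zero fun α _ => ?_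
    rw [(anti_al n α).2 e hinj, mul_zero]

lemma anti_expand_mul {n : ℕ} (F S : MvPowerSeries (Fin n) A) (hF : Anti F) (D : ℕ)
    (e : Fin n →₀ ℕ) (he : e.degree ≤ D) :
    MvPowerSeries.coeff e (F * S) =
      ∑ α ∈ PP n D, MvPowerSeries.coeff (ex n α) F * MvPowerSeries.coeff e (al n A α * S) := by
  rw [MvPowerSeries.coeff_mul]
  simp only [MvPowerSeries.coeff_mul, Finset.mul_sum]
  rw [Finset.sum_comm]
  refine Finset.sum_congr rfl fun x hx => ?_
  rw [Finset.HasAntidiagonal.mem_antidiagonal] at hx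
  rw [anti_expand F hF D x.1 (by
    rw [← hx, map_add] at he; omega), Finset.sum_mul]
  refine Finset.sum_congr rfl fun α _ => ?_
  ring

end
end NL


namespace NL

section
variable {A : Type*} [CommRing A]

lemma vd_coeff_zero (n : ℕ) : MvPowerSeries.coeff (ex n p0) (vd n A) = 1 := by
  have h := coeff_EE_zero (A := A) n 0 1 (by simp)
  have h1 : HH n (1 : PowerSeries A) = 1 := map_one (PR n A)
  have he : ee n (0 : A) = 1 := by simp [ee, pp]
  rw [EE, UU, he, h1, mul_one, mul_one] at h
  exact h

lemma p0_len (n : ℕ) : p0.LengthLE n := fun _ _ => rfl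

lemma p0_weight : p0.weight = 0 := by simp [Partn.weight, p0]

lemma order_vd_le [Nontrivial A] (n : ℕ) : (vd n A).order ≤ (tri n : ℕ) := by
  have := MvPowerSeries.order_le (f := vd n A) (d := ex n p0) (by rw [vd_coeff_zero]; exact one_ne_zero)
  rw [degree_ex n p0 (p0_len n), p0_weight, zero_add] at this
  exact this

lemma coeff_exp_mul [IsDomain A] {k : ℕ} (U Y : MvPowerSeries (Fin k) A) (hF : Anti (vd k A * U))
    (D : ℕ) (e : Fin k →₀ ℕ) (he : e.degree + tri k ≤ D) :
    MvPowerSeries.coeff e (U * Y) = ∑ ν ∈ PP k D, MvPowerSeries.coeff (ex k ν) (vd k A * U) *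
      MvPowerSeries.coeff e (tp k A (schur k ν.parts) * Y) := by
  set Z : MvPowerSeries (Fin k) A := U - ∑ ν ∈ PP k D,
    MvPowerSeries.C (MvPowerSeries.coeff (ex k ν) (vd k A * U)) * tp k A (schur k ν.parts) with hZ
  have h1 : ∀ g : Fin k →₀ ℕ, g.degree < D + 1 → MvPowerSeries.coeff g (vd k A * Z) = 0 := by
    intro g hg
    have h2 : vd k A * Z = vd k A * U - ∑ ν ∈ PP k D,
      MvPowerSeries.C (MvPowerSeries.coeff (ex k ν) (vd k A * U)) * al k A ν := by
      rw [hZ, mul_sub, Finset.mul_sum]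
      congr 1
      refine Finset.sum_congr rfl fun ν _ => ?_
      rw [← al_schur]; ring
    rw [h2, map_sub, map_sum, anti_expand _ hF D g (by omega), sub_eq_zero]
    refine Finset.sum_congr rfl fun ν _ => ?_
    rw [MvPowerSeries.coeff_C_mul]
  have h2 := MvPowerSeries.nat_le_order h1
  rw [MvPowerSeries.order_mul] at h2
  have h3 : (e.degree : ℕ∞) < Z.order := by
    by_contra hc
    push Not at hc
    have h4 := h2.trans (add_le_add (order_vd_le k) hc)
    have h5 : D + 1 ≤ tri k + e.degree := by exact_mod_cast h4
    omega
  have h4 : MvPowerSeries.coeff e (Z * Y) = 0 := by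
    apply MvPowerSeries.coeff_of_lt_order
    exact lt_of_lt_of_le (lt_of_lt_of_le h3 le_self_add) MvPowerSeries.le_order_mul
  rw [hZ, sub_mul, map_sub, sub_eq_zero] at h4
  rw [h4, Finset.sum_mul, map_sum]
  refine Finset.sum_congr rfl fun ν _ => ?_
  rw [mul_assoc, MvPowerSeries.coeff_C_mul]

lemma degree_app {a b : ℕ} (e : Fin a →₀ ℕ) (f : Fin b →₀ ℕ) :
    (app e f).degree = e.degree + f.degree := by
  rw [Finsupp.degree_eq_sum, Finsupp.degree_eq_sum, Finsupp.degree_eq_sum, Fin.sum_univ_add]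
  simp [app]

lemma Ph_exp_mul [IsDomain A] {a b : ℕ} (U : MvPowerSeries (Fin (a + b)) A)
    (Y : MvPowerSeries (Fin a) (MvPowerSeries (Fin b) A)) (hF : Anti (vd (a + b) A * U))
    (D : ℕ) (e : Fin a →₀ ℕ) (f : Fin b →₀ ℕ) (he : e.degree + f.degree + tri (a + b) ≤ D) :
    MvPowerSeries.coeff f (MvPowerSeries.coeff e (Ph a b A U * Y)) =
    ∑ ν ∈ PP (a + b) D, MvPowerSeries.coeff (ex (a + b) ν) (vd (a + b) A * U) *
      MvPowerSeries.coeff f (MvPowerSeries.coeff e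
        (Ph a b A (tp (a + b) A (schur (a + b) ν.parts)) * Y)) := by
  obtain ⟨Y, rfl⟩ := Ph_surj Y
  simp only [← map_mul, coeff_Ph]
  exact coeff_exp_mul U Y hF D _ (by rw [degree_app]; exact he)

/-- The Cauchy kernel. -/
noncomputable def KK (a b : ℕ) (A : Type*) [CommRing A] :
    MvPowerSeries (Fin a) (MvPowerSeries (Fin b) A) :=
  HH a (Hg fun j : Fin b => (MvPowerSeries.X j : MvPowerSeries (Fin b) A))

lemma KK_inv (a b : ℕ) : (∏ i, ∏ j, (1 - MvPowerSeries.X i *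
        MvPowerSeries.C (MvPowerSeries.X j))) * KK a b A = 1 := by
  rw [KK, HH, PR_eq, ← Finset.prod_mul_distrib]
  refine Finset.prod_eq_one fun i _ => ?_
  rw [Hg, map_prod, ← Finset.prod_mul_distrib]
  refine Finset.prod_eq_one fun j _ => ?_
  have := congrArg (io i) (geo_mul (MvPowerSeries.X j : MvPowerSeries (Fin b) A))
  rw [map_mul, map_sub, map_mul, io_C, io_X, map_one] at this
  rw [mul_comm (MvPowerSeries.X i)]
  exact this

lemma ee_zero (n : ℕ) : ee n (0 : A) = 1 := by simp [ee, pp]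

lemma fact0 (a b : ℕ) (H : PowerSeries A) :
    Ph a b A (UU (a + b) 0 H) * (vd a _ * MvPowerSeries.C (vd b A)) =
      EE a (MvPowerSeries.C 0) (PowerSeries.map (MvPowerSeries.C (σ := Fin b)) H) *
        MvPowerSeries.C (EE b 0 H) := by
  rw [UU, map_mul, Ph_HH, ee_zero, EE, EE, UU, UU, map_zero, ee_zero, ee_zero]
  simp only [map_mul, map_one]
  ring

lemma fact1 (a b : ℕ) (H : PowerSeries A) :
    Ph a b A (UU (a + b) 1 H) * (vd a _ * MvPowerSeries.C (vd b A) * KK a b A) =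
      EE a (MvPowerSeries.C 1) (PowerSeries.map (MvPowerSeries.C (σ := Fin b)) H) *
        MvPowerSeries.C (EE b 1 H) := by
  rw [UU, map_mul, Ph_HH, Ph_ee, EE, EE, UU, UU]
  have h := KK_inv (A := A) a b
  simp only [map_mul, map_one, one_mul]
  linear_combination (ee a 1 * MvPowerSeries.C (ee b 1) *
    (HH a (PowerSeries.map (MvPowerSeries.C (σ := Fin b)) H) * MvPowerSeries.C (HH b H)) *
    (vd a _ * MvPowerSeries.C (vd b A))) * h

lemma coeff_EE_EE {a b : ℕ} (ε : A) (H : PowerSeries A) (e : Fin a →₀ ℕ) (f : Fin b →₀ ℕ) :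
    MvPowerSeries.coeff f (MvPowerSeries.coeff e
      (EE a (MvPowerSeries.C ε) (PowerSeries.map (MvPowerSeries.C (σ := Fin b)) H) *
        MvPowerSeries.C (EE b ε H))) =
    MvPowerSeries.coeff e (EE a ε H) * MvPowerSeries.coeff f (EE b ε H) := by
  rw [MvPowerSeries.coeff_mul_C, coeff_EE_map, MvPowerSeries.coeff_C_mul]

lemma Ph_map {B : Type*} [CommRing B] (φ : A →+* B) {a b : ℕ} (F : MvPowerSeries (Fin (a + b)) A) :
    MvPowerSeries.map (MvPowerSeries.map φ) (Ph a b A F) = Ph a b B (MvPowerSeries.map φ F) := by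
  ext e f
  simp [coeff_Ph]

lemma map_KK {B : Type*} [CommRing B] (φ : A →+* B) (a b : ℕ) :
    MvPowerSeries.map (MvPowerSeries.map φ) (KK a b A) = KK a b B := by
  rw [KK, map_HH, map_Hg, KK]
  simp

end

/-- structure constants without kernel -/
noncomputable def dZ (a b : ℕ) (l m ν : Partn) : ℤ :=
  MvPowerSeries.coeff (ex b m) (MvPowerSeries.coeff (ex a l)
    (Ph a b ℤ (tp (a + b) ℤ (schur (a + b) ν.parts)) * (vd a _ * MvPowerSeries.C (vd b ℤ))))

/-- structure constants with kernel -/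
noncomputable def kZ (a b : ℕ) (l m ν : Partn) : ℤ :=
  MvPowerSeries.coeff (ex b m) (MvPowerSeries.coeff (ex a l)
    (Ph a b ℤ (tp (a + b) ℤ (schur (a + b) ν.parts)) *
      (vd a _ * MvPowerSeries.C (vd b ℤ) * KK a b ℤ)))

section
variable {A : Type*} [CommRing A] [IsDomain A]

lemma prod0 (a b : ℕ) (H : PowerSeries A) (l m : Partn) (D : ℕ)
    (hD : (ex a l).degree + (ex b m).degree + tri (a + b) ≤ D) :
    MvPowerSeries.coeff (ex a l) (EE a 0 H) * MvPowerSeries.coeff (ex b m) (EE b 0 H) =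
    ∑ ν ∈ PP (a + b) D, MvPowerSeries.coeff (ex (a + b) ν) (EE (a + b) 0 H) * (dZ a b l m ν : A) := by
  rw [← coeff_EE_EE, ← fact0, Ph_exp_mul _ _ (anti_EE (a + b) 0 H) D _ _ hD]
  refine Finset.sum_congr rfl fun ν _ => ?_
  rw [EE]
  congr 1
  rw [dZ, ← eq_intCast (Int.castRingHom A), ← MvPowerSeries.coeff_map, ← MvPowerSeries.coeff_map,
    map_mul (MvPowerSeries.map _), Ph_map, map_tp, map_mul (MvPowerSeries.map _), map_vd, MvPowerSeries.map_C, map_vd]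

lemma prod1 (a b : ℕ) (H : PowerSeries A) (l m : Partn) (D : ℕ)
    (hD : (ex a l).degree + (ex b m).degree + tri (a + b) ≤ D) :
    MvPowerSeries.coeff (ex a l) (EE a 1 H) * MvPowerSeries.coeff (ex b m) (EE b 1 H) =
    ∑ ν ∈ PP (a + b) D, MvPowerSeries.coeff (ex (a + b) ν) (EE (a + b) 1 H) * (kZ a b l m ν : A) := by
  rw [← coeff_EE_EE, ← fact1, Ph_exp_mul _ _ (anti_EE (a + b) 1 H) D _ _ hD]
  refine Finset.sum_congr rfl fun ν _ => ?_
  rw [EE]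
  congr 1
  rw [kZ, ← eq_intCast (Int.castRingHom A), ← MvPowerSeries.coeff_map, ← MvPowerSeries.coeff_map,
    map_mul (MvPowerSeries.map _), Ph_map, map_tp, map_mul (MvPowerSeries.map _),
    map_mul (MvPowerSeries.map _), map_vd, MvPowerSeries.map_C, map_vd, map_KK]

end

end NL


namespace NL

lemma hc_mul {N : ℕ} (s d : ZP N) (j : ℕ) (hd : d.IsHomogeneous j) (i : ℕ) :
    homogeneousComponent (i + j) (s * d) = homogeneousComponent i s * d := by
  conv_lhs => rw [← sum_homogeneousComponent s, Finset.sum_mul, map_sum]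
  have h : ∀ r, homogeneousComponent (i + j) (homogeneousComponent r s * d) =
      if i = r then homogeneousComponent r s * d else 0 := by
    intro r
    rw [homogeneousComponent_of_mem (n := r + j)
      ((homogeneousComponent_isHomogeneous r s).mul hd)]
    simp
  simp only [h]
  rw [Finset.sum_ite_eq]
  split_ifs with hi
  · rfl
  · rw [homogeneousComponent_eq_zero, zero_mul]
    simp at hi; omega

lemma hom_of_mul {N : ℕ} (s d : ZP N) (j w : ℕ) (hd : d.IsHomogeneous j) (h0 : d ≠ 0)
    (h : (s * d).IsHomogeneous (w + j)) : s.IsHomogeneous w := by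
  intro e he
  by_contra hne
  have hdeg : e.degree ≠ w := by
    rw [Finsupp.degree_eq_weight_one]; exact hne
  have h1 := hc_mul s d j hd e.degree
  rw [homogeneousComponent_of_mem h, if_neg (by omega)] at h1
  have h2 : homogeneousComponent e.degree s = 0 := by
    rcases mul_eq_zero.1 h1.symm with h | h
    · exact h
    · exact absurd h h0
  have h3 := congrArg (coeff e) h2
  rw [coeff_homogeneousComponent, if_pos rfl, coeff_zero] at h3
  exact he h3

lemma alternant_hom (N : ℕ) (p : Partn) (hp : p.LengthLE N) :
    (alternant N p.parts).IsHomogeneous (p.weight + tri N) := by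
  rw [alternant, Matrix.det_apply']
  refine IsHomogeneous.sum _ _ _ fun σ _ => ?_
  have h : (((Equiv.Perm.sign σ : ℤˣ) : ℤ) : ZP N) = C (((Equiv.Perm.sign σ : ℤˣ) : ℤ)) := by simp
  rw [h]
  refine IsHomogeneous.C_mul ?_ _
  rw [← degree_ex N p hp, Finsupp.degree_eq_sum]
  refine IsHomogeneous.prod _ _ _ fun i _ => ?_
  exact isHomogeneous_X_pow _ _

lemma vander_eq (N : ℕ) : vandermondeP N = alternant N p0.parts := by
  simp [vandermondeP, alternant, p0]

lemma vander_hom (N : ℕ) : (vandermondeP N).IsHomogeneous (tri N) := by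
  have := alternant_hom N p0 (p0_len N)
  rwa [p0_weight, zero_add, ← vander_eq] at this

lemma schur_hom (N : ℕ) (p : Partn) (hp : p.LengthLE N) :
    (schur N p.parts).IsHomogeneous p.weight :=
  hom_of_mul _ _ _ _ (vander_hom N) (vandermondeP_ne N) (by
    rw [schur_mul]; exact alternant_hom N p hp)

/-- coefficient of `s_ν` in `s_l s_m` in `N` variables -/
noncomputable def cc (N : ℕ) (l m ν : Partn) : ℤ :=
  coeff (ex N ν) (schur N l.parts * schur N m.parts * vandermondeP N)

lemma cc_zero (N : ℕ) (l m ν : Partn) (hl : l.LengthLE N) (hm : m.LengthLE N) (hν : ν.LengthLE N)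
    (h : ν.weight ≠ l.weight + m.weight) : cc N l m ν = 0 := by
  refine IsHomogeneous.coeff_eq_zero (((schur_hom N l hl).mul (schur_hom N m hm)).mul
    (vander_hom N)) ?_
  rw [degree_ex N ν hν]
  omega

lemma schur_stab (a N : ℕ) (p : Partn) (h1 : p.LengthLE a) (h2 : p.LengthLE N) :
    MvPowerSeries.coeff (ex a p) (EE a 0 (Ht N)) = schur N p.parts := by
  rw [schur_eq]
  rcases le_total a N with h | h
  · exact (stab_le h 0 _ (cc_Hg _) p h1).symm
  · exact stab_le h 0 _ (cc_Hg _) p h2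

lemma coeff_alternant (N : ℕ) (p q : Partn) (hp : p.LengthLE N) (hq : q.LengthLE N) :
    coeff (ex N p) (alternant N q.parts) = if p = q then 1 else 0 := by
  rw [← coeff_al (A := ℤ) N p q hp hq, al, coeff_tp]; simp

lemma cc_eq (a b N : ℕ) (hN : a + b ≤ N) (l m ν : Partn) (hl : l.LengthLE a) (hm : m.LengthLE b)
    (hν : ν.LengthLE (a + b)) : cc N l m ν = dZ a b l m ν := by
  have hp := prod0 a b (Ht N) l m
    ((ex a l).degree + (ex b m).degree + tri (a + b) + ν.weight) (by omega)
  rw [schur_stab a N l hl (len_mono hl (by omega)), schur_stab b N m hm (len_mono hm (by omega))] at hp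
  rw [cc, hp, Finset.sum_mul, coeff_sum]
  rw [Finset.sum_eq_single ν]
  · rw [schur_stab _ _ _ hν (len_mono hν hN), mul_right_comm, schur_mul, mul_comm,
      ← eq_intCast (C : ℤ →+* ZP N), coeff_C_mul,
      coeff_alternant _ _ _ (len_mono hν hN) (len_mono hν hN), if_pos rfl, mul_one]
  · intro q hq hne
    have hq' := (mem_PP.1 hq).1
    rw [schur_stab _ _ _ hq' (len_mono hq' hN), mul_right_comm, schur_mul, mul_comm,
      ← eq_intCast (C : ℤ →+* ZP N), coeff_C_mul,
      coeff_alternant _ _ _ (len_mono hν hN) (len_mono hq' hN), if_neg hne.symm, mul_zero]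
  · intro h
    exact absurd (mem_PP.2 ⟨hν, by omega⟩) h

lemma lrCoeff_eq (l m ν : Partn) : lrCoeff l m ν = if ν.weight = l.weight + m.weight then
    cc (l.weight + m.weight) l m ν else 0 := rfl

lemma cc_lr (N : ℕ) (l m ν : Partn) (hl : l.LengthLE N) (hm : m.LengthLE N) (hν : ν.LengthLE N)
    (h : ν.weight ≤ N) : cc N l m ν = lrCoeff l m ν := by
  rw [lrCoeff_eq]
  split_ifs with hw
  · have h1 : ν.LengthLE (l.weight + m.weight) := hw ▸ len_weight ν
    rw [cc_eq l.weight m.weight N (by omega) l m ν (len_weight l) (len_weight m) h1,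
      cc_eq l.weight m.weight _ le_rfl l m ν (len_weight l) (len_weight m) h1]
  · exact cc_zero N l m ν hl hm hν hw

lemma dZ_lr (a b : ℕ) (l m ν : Partn) (hl : l.LengthLE a) (hm : m.LengthLE b)
    (hν : ν.LengthLE (a + b)) (hw : l.weight + m.weight ≤ a + b) :
    dZ a b l m ν = lrCoeff l m ν := by
  rw [← cc_eq a b _ le_rfl l m ν hl hm hν]
  by_cases h : ν.weight = l.weight + m.weight
  · exact cc_lr _ _ _ _ (len_mono hl (by omega)) (len_mono hm (by omega)) hν (by omega)
  · rw [cc_zero _ _ _ _ (len_mono hl (by omega)) (len_mono hm (by omega)) hν h, lrCoeff_eq, if_neg h]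

end NL


namespace NL

section
variable {A : Type*} [CommRing A]

/-- Symmetric power series. -/
def Symc {n : ℕ} (S : MvPowerSeries (Fin n) A) : Prop :=
  ∀ (σ : Equiv.Perm (Fin n)) (e : Fin n →₀ ℕ),
    MvPowerSeries.coeff (fs (e ∘ σ)) S = MvPowerSeries.coeff e S

lemma Symc.mul_anti {n : ℕ} {S F : MvPowerSeries (Fin n) A} (hS : Symc S) (hF : Anti F)
    (h2 : ∀ x : A, x + x = 0 → x = 0) : Anti (S * F) := by
  have h1 : ∀ (σ : Equiv.Perm (Fin n)) (e : Fin n →₀ ℕ), MvPowerSeries.coeff (fs (e ∘ σ)) (S * F) =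
    (((Equiv.Perm.sign σ : ℤˣ) : ℤ) : A) * MvPowerSeries.coeff e (S * F) := by
    intro σ e
    rw [MvPowerSeries.coeff_mul, MvPowerSeries.coeff_mul, Finset.mul_sum]
    symm
    refine Finset.sum_nbij' (fun x => (fs (x.1 ∘ σ), fs (x.2 ∘ σ)))
      (fun x => (fs (x.1 ∘ σ.symm), fs (x.2 ∘ σ.symm))) ?_ ?_ ?_ ?_ ?_
    · intro x hx
      rw [Finset.HasAntidiagonal.mem_antidiagonal] at hx ⊢
      rw [← hx]; ext i; simp
    · intro x hx
      rw [Finset.HasAntidiagonal.mem_antidiagonal] at hx ⊢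
      ext i
      have := DFunLike.congr_fun hx (σ.symm i)
      simpa using this
    · intro x _; ext i <;> simp
    · intro x _; ext i <;> simp
    · intro x _
      simp only
      rw [hS σ x.1, hF.1 σ x.2]; ring
  refine ⟨h1, fun e he => ?_⟩
  simp only [Function.Injective, not_forall] at he
  obtain ⟨i, j, hij, hne⟩ := he
  have h3 := h1 (Equiv.swap i j) e
  have h4 : fs (e ∘ Equiv.swap i j) = e := by
    ext r
    simp only [Finsupp.equivFunOnFinite_symm_apply_apply, Function.comp_apply, Equiv.swap_apply_def]
    split_ifs with h h'
    · rw [h, hij]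
    · rw [h', hij]
    · rfl
  rw [h4, Equiv.Perm.sign_swap hne] at h3
  apply h2
  simp at h3
  linear_combination h3

lemma schur_rename (N : ℕ) (p : Partn) (σ : Equiv.Perm (Fin N)) :
    rename σ (schur N p.parts) = schur N p.parts := by
  rw [schur_eq]
  have h := coeff_EE_map ((rename σ : ZP N →ₐ[ℤ] ZP N) : ZP N →+* ZP N) N 0 (Ht N) (ex N p)
  have h1 : PowerSeries.map ((rename σ : ZP N →ₐ[ℤ] ZP N) : ZP N →+* ZP N) (Ht N) = Ht N := by
    rw [map_Hg, Hg, Ht, Hg]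
    rw [← Equiv.prod_comp σ (fun a => geo (X a : ZP N))]
    simp
  rw [h1, map_zero] at h
  exact h.symm

lemma symc_schur (N : ℕ) (p : Partn) : Symc (tp N A (schur N p.parts)) := by
  intro σ e
  rw [coeff_tp, coeff_tp]
  have h := coeff_rename_mapDomain σ.symm σ.symm.injective (schur N p.parts) e
  rw [schur_rename] at h
  rw [← h]
  have : Finsupp.mapDomain σ.symm e = fs (e ∘ σ) := by
    ext i
    rw [← Finsupp.equivMapDomain_eq_mapDomain, Finsupp.equivMapDomain_apply]
    simp
  rw [this]

lemma symc_Ph_left {a b : ℕ} (S : MvPowerSeries (Fin (a + b)) A) (hS : Symc S) :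
    Symc (Ph a b A S) := by
  intro σ e
  ext f
  rw [coeff_Ph, coeff_Ph, ← hS (finSumFinEquiv.permCongr (Equiv.sumCongr σ (Equiv.refl (Fin b)))) (app e f)]
  congr 2
  ext i
  refine Fin.addCases (fun i => ?_) (fun i => ?_) i <;> simp [app, Equiv.permCongr_apply]

lemma symc_Ph_right {a b : ℕ} (S : MvPowerSeries (Fin (a + b)) A) (hS : Symc S)
    (e : Fin a →₀ ℕ) : Symc (MvPowerSeries.coeff e (Ph a b A S)) := by
  intro σ f
  rw [coeff_Ph, coeff_Ph, ← hS (finSumFinEquiv.permCongr (Equiv.sumCongr (Equiv.refl (Fin a)) σ)) (app e f)]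
  congr 2
  ext i
  refine Fin.addCases (fun i => ?_) (fun i => ?_) i <;> simp [app, Equiv.permCongr_apply]

lemma al_p0 (n : ℕ) : al n A p0 = vd n A := by
  rw [al, ← vander_eq, tp_vandermondeP]

lemma anti_vd (n : ℕ) : Anti (vd n A) := by
  rw [← al_p0]; exact anti_al n p0

/-- finite linear combinations of symmetric series -/
lemma symc_sum_mul {n : ℕ} {ι : Type*} (s : Finset ι) (S : ι → MvPowerSeries (Fin n) A)
    (c : ι → ℤ) (h : ∀ i ∈ s, Symc (S i)) :
    Symc (∑ i ∈ s, S i * MvPowerSeries.C ((c i : ℤ) : A)) := by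
  intro σ e
  rw [map_sum, map_sum]
  refine Finset.sum_congr rfl fun i hi => ?_
  rw [MvPowerSeries.coeff_mul_C, MvPowerSeries.coeff_mul_C, h i hi]

lemma coeff_al_mul (n : ℕ) (p q r : Partn) :
    MvPowerSeries.coeff (ex n r) (al n A p * tp n A (schur n q.parts)) = ((cc n p q r : ℤ) : A) := by
  rw [al, ← map_mul, coeff_tp, cc, ← schur_mul]
  congr 2
  ring

lemma coeff_al_mul' (n : ℕ) (p q r : Partn) :
    MvPowerSeries.coeff (ex n r) (al n A p * tp n A (schur n q.parts)) = ((cc n q p r : ℤ) : A) := by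
  rw [al, ← map_mul, coeff_tp, cc, ← schur_mul]
  congr 2
  ring

end

lemma tp_eval (b : ℕ) (f : ZP b) :
    eval₂Hom (Int.castRingHom (MvPowerSeries (Fin b) ℤ)) MvPowerSeries.X f = tp b ℤ f := by
  have : eval₂Hom (Int.castRingHom (MvPowerSeries (Fin b) ℤ)) MvPowerSeries.X = tp b ℤ := by
    refine MvPolynomial.ringHom_ext (fun r => ?_) (fun i => ?_)
    · simp
    · simp [tp_X]
  rw [this]

lemma Tcoeff (a b : ℕ) (hab : a ≤ b) (l α : Partn) (D : ℕ) (hD : (ex a l).degree ≤ D) :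
    MvPowerSeries.coeff (ex a l) (al a (MvPowerSeries (Fin b) ℤ) α * KK a b ℤ) =
      ∑ σ ∈ PP a D, tp b ℤ (schur b σ.parts) * ((cc a σ α l : ℤ) : MvPowerSeries (Fin b) ℤ) := by
  have h1 : al a (MvPowerSeries (Fin b) ℤ) α * KK a b ℤ =
      EE a 0 (Hg fun j : Fin b => (MvPowerSeries.X j : MvPowerSeries (Fin b) ℤ)) *
        tp a _ (schur a α.parts) := by
    rw [← al_schur, EE, UU, ee_zero, KK]; ring
  rw [h1, anti_expand_mul _ _ (anti_EE _ _ _) D _ hD]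
  refine Finset.sum_congr rfl fun σ hσ => ?_
  rw [coeff_al_mul]
  congr 1
  have hl := (mem_PP.1 hσ).1
  rw [← stab_le hab 0 _ (cc_Hg _) σ hl, schur_spec _ _ _ le_rfl (len_mono hl hab)]
  exact tp_eval b _

lemma two_B (b : ℕ) (x : MvPowerSeries (Fin b) ℤ) (h : x + x = 0) : x = 0 := by
  ext e
  have := congrArg (MvPowerSeries.coeff e) h
  simp at this ⊢
  exact this

lemma kZ_eq (a b : ℕ) (hab : a ≤ b) (l m ν : Partn) (D : ℕ) (h1 : (ex a l).degree ≤ D)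
    (h2 : (ex b m).degree ≤ D) :
    kZ a b l m ν = ∑ α ∈ PP a D, ∑ β ∈ PP b D, ∑ σ ∈ PP a D,
      dZ a b α β ν * (cc a σ α l * cc b σ β m) := by
  set S := tp (a + b) ℤ (schur (a + b) ν.parts) with hS
  have hsym : Symc S := symc_schur _ _
  have e1 : Ph a b ℤ S * (vd a _ * MvPowerSeries.C (vd b ℤ) * KK a b ℤ) =
      (Ph a b ℤ S * vd a _) * (KK a b ℤ * MvPowerSeries.C (vd b ℤ)) := by ring
  have hA : Anti (Ph a b ℤ S * vd a _) :=
    (symc_Ph_left S hsym).mul_anti (anti_vd a) (two_B b)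
  rw [kZ, ← hS, e1, anti_expand_mul _ _ hA D _ h1, map_sum]
  refine Finset.sum_congr rfl fun α hα => ?_
  rw [← mul_assoc (al a _ α), MvPowerSeries.coeff_mul_C, Tcoeff a b hab l α D h1]
  have e2 : ∀ T : MvPowerSeries (Fin b) ℤ,
      MvPowerSeries.coeff (ex a α) (Ph a b ℤ S * vd a _) * (T * vd b ℤ) =
      MvPowerSeries.coeff (ex a α) (Ph a b ℤ S * (vd a _ * MvPowerSeries.C (vd b ℤ))) * T := by
    intro T
    rw [← mul_assoc (Ph a b ℤ S), MvPowerSeries.coeff_mul_C]; ring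
  have hP : Anti (MvPowerSeries.coeff (ex a α)
      (Ph a b ℤ S * (vd a _ * MvPowerSeries.C (vd b ℤ)))) := by
    rw [← mul_assoc, MvPowerSeries.coeff_mul_C]
    refine Symc.mul_anti ?_ (anti_vd b) (by intro x hx; omega)
    intro σ f
    rw [MvPowerSeries.coeff_mul, map_sum, map_sum]
    refine Finset.sum_congr rfl fun x _ => ?_
    have hc : MvPowerSeries.coeff x.2 (vd a (MvPowerSeries (Fin b) ℤ)) =
        MvPowerSeries.C (MvPowerSeries.coeff x.2 (vd a ℤ)) := by
      rw [← MvPowerSeries.coeff_map, map_vd]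
    rw [hc, MvPowerSeries.coeff_mul_C, MvPowerSeries.coeff_mul_C, symc_Ph_right S hsym x.1 σ f]
  rw [e2, anti_expand_mul _ _ hP D _ h2]
  refine Finset.sum_congr rfl fun β hβ => ?_
  rw [← Finset.mul_sum, dZ]
  congr 1
  rw [Finset.mul_sum, map_sum]
  refine Finset.sum_congr rfl fun σ hσ => ?_
  rw [← mul_assoc, ← eq_intCast (MvPowerSeries.C : ℤ →+* MvPowerSeries (Fin b) ℤ),
    MvPowerSeries.coeff_mul_C, coeff_al_mul', mul_comm]
  simp

end NL

namespace NL

lemma lr_ne {p q r : Partn} (h : lrCoeff p q r ≠ 0) : r.weight = p.weight + q.weight := by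
  by_contra hc
  exact h (by rw [lrCoeff_eq, if_neg hc])

lemma lr_comm (p q r : Partn) : lrCoeff p q r = lrCoeff q p r := by
  rw [lrCoeff_eq, lrCoeff_eq, add_comm q.weight]
  have h : cc (p.weight + q.weight) p q r = cc (p.weight + q.weight) q p r := by
    rw [cc, cc, mul_comm (schur _ p.parts)]
  rw [h]

/-- the Newell-Littlewood coefficient -/
noncomputable def nl (l m ν : Partn) : ℤ :=
  ∑ᶠ (σ : Partn) (α : Partn) (β : Partn), lrCoeff σ α l * lrCoeff σ β m * lrCoeff α β ν

lemma nl_eq (l m ν : Partn) (S T U : Finset Partn)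
    (hS : ∀ p : Partn, p.weight ≤ l.weight → p.weight ≤ m.weight → p ∈ S)
    (hT : ∀ p : Partn, p.weight ≤ l.weight → p ∈ T)
    (hU : ∀ p : Partn, p.weight ≤ m.weight → p ∈ U) :
    nl l m ν = ∑ σ ∈ S, ∑ α ∈ T, ∑ β ∈ U, lrCoeff σ α l * lrCoeff σ β m * lrCoeff α β ν := by
  have h3 : ∀ σ α : Partn, (∑ᶠ β : Partn, lrCoeff σ α l * lrCoeff σ β m * lrCoeff α β ν) =
      ∑ β ∈ U, lrCoeff σ α l * lrCoeff σ β m * lrCoeff α β ν := by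
    intro σ α
    apply finsum_eq_sum_of_support_subset
    intro β hβ
    have h := right_ne_zero_of_mul (left_ne_zero_of_mul hβ)
    have := lr_ne h
    exact hU β (by omega)
  have h2 : ∀ σ : Partn, (∑ᶠ (α : Partn) (β : Partn),
      lrCoeff σ α l * lrCoeff σ β m * lrCoeff α β ν) =
      ∑ α ∈ T, ∑ β ∈ U, lrCoeff σ α l * lrCoeff σ β m * lrCoeff α β ν := by
    intro σ
    simp only [h3]
    apply finsum_eq_sum_of_support_subset
    intro α hα
    obtain ⟨β, -, hβ⟩ := Finset.exists_ne_zero_of_sum_ne_zero hα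
    have h := left_ne_zero_of_mul (left_ne_zero_of_mul hβ)
    have := lr_ne h
    exact hT α (by omega)
  rw [nl]
  simp only [h2]
  apply finsum_eq_sum_of_support_subset
  intro σ hσ
  obtain ⟨α, -, hα⟩ := Finset.exists_ne_zero_of_sum_ne_zero hσ
  obtain ⟨β, -, hβ⟩ := Finset.exists_ne_zero_of_sum_ne_zero hα
  have h := lr_ne (left_ne_zero_of_mul (left_ne_zero_of_mul hβ))
  have h' := lr_ne (right_ne_zero_of_mul (left_ne_zero_of_mul hβ))
  exact hS σ (by omega) (by omega)

lemma mem_PP_of (p : Partn) {n D : ℕ} (h : p.weight ≤ n) (h' : p.weight ≤ D) : p ∈ PP n D :=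
  mem_PP.2 ⟨len_mono (len_weight p) h, h'⟩

lemma nl_eq' (l m ν : Partn) (W : ℕ) (hW : l.weight + m.weight ≤ W) :
    nl l m ν = ∑ σ ∈ PP W W, ∑ α ∈ PP W W, ∑ β ∈ PP W W,
      lrCoeff σ α l * lrCoeff σ β m * lrCoeff α β ν :=
  nl_eq l m ν _ _ _ (fun p _ _ => mem_PP_of p (by omega) (by omega))
    (fun p _ => mem_PP_of p (by omega) (by omega)) (fun p _ => mem_PP_of p (by omega) (by omega))

lemma nl_comm (l m ν : Partn) : nl l m ν = nl m l ν := by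
  rw [nl_eq' l m ν _ le_rfl, nl_eq' m l ν (l.weight + m.weight) (by omega)]
  refine Finset.sum_congr rfl fun σ _ => ?_
  rw [Finset.sum_comm]
  refine Finset.sum_congr rfl fun α _ => Finset.sum_congr rfl fun β _ => ?_
  rw [lr_comm β α ν]; ring

lemma nl_zero (l m ν : Partn) (h : l.weight + m.weight < ν.weight) : nl l m ν = 0 := by
  rw [nl_eq' l m ν _ le_rfl]
  refine Finset.sum_eq_zero fun σ _ => Finset.sum_eq_zero fun α _ => Finset.sum_eq_zero fun β _ => ?_
  by_contra hβ
  have h1 := lr_ne (left_ne_zero_of_mul (left_ne_zero_of_mul hβ))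
  have h2 := lr_ne (right_ne_zero_of_mul (left_ne_zero_of_mul hβ))
  have h3 := lr_ne (right_ne_zero_of_mul hβ)
  omega

lemma kZ_nl (a b : ℕ) (hab : a ≤ b) (l m ν : Partn) (hl : l.weight ≤ a) (hm : m.weight ≤ b)
    (hν : ν.LengthLE (a + b)) : kZ a b l m ν = nl l m ν := by
  have dl := degree_ex a l (len_mono (len_weight l) hl)
  have dm := degree_ex b m (len_mono (len_weight m) hm)
  set D := (ex a l).degree + (ex b m).degree with hD
  rw [kZ_eq a b hab l m ν D (by omega) (by omega)]
  rw [nl_eq l m ν (PP a D) (PP a D) (PP b D)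
    (fun p _ _ => mem_PP_of p (by omega) (by omega))
    (fun p _ => mem_PP_of p (by omega) (by omega)) (fun p _ => mem_PP_of p (by omega) (by omega))]
  have key : ∀ σ ∈ PP a D, ∀ α ∈ PP a D, ∀ β ∈ PP b D,
      dZ a b α β ν * (cc a σ α l * cc b σ β m) =
        lrCoeff σ α l * lrCoeff σ β m * lrCoeff α β ν := by
    intro σ hσ α hα β hβ
    rw [mem_PP] at hσ hα hβ
    rw [cc_lr a σ α l hσ.1 hα.1 (len_mono (len_weight l) hl) hl,
      cc_lr b σ β m (len_mono hσ.1 hab) hβ.1 (len_mono (len_weight m) hm) hm]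
    by_cases h1 : lrCoeff σ α l = 0
    · rw [h1]; ring
    by_cases h2 : lrCoeff σ β m = 0
    · rw [h2]; ring
    have e1 := lr_ne h1
    have e2 := lr_ne h2
    rw [dZ_lr a b α β ν hα.1 hβ.1 hν (by omega)]; ring
  calc _ = ∑ α ∈ PP a D, ∑ β ∈ PP b D, ∑ σ ∈ PP a D,
        lrCoeff σ α l * lrCoeff σ β m * lrCoeff α β ν := by
        exact Finset.sum_congr rfl fun α hα => Finset.sum_congr rfl fun β hβ =>
          Finset.sum_congr rfl fun σ hσ => key σ hσ α hα β hβ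
    _ = ∑ α ∈ PP a D, ∑ σ ∈ PP a D, ∑ β ∈ PP b D,
        lrCoeff σ α l * lrCoeff σ β m * lrCoeff α β ν :=
        Finset.sum_congr rfl fun α _ => Finset.sum_comm
    _ = _ := Finset.sum_comm

lemma main_le (l m : Partn) (k : ℕ) (hk : l.weight + m.weight ≤ k) (hlm : l.weight ≤ m.weight) :
    spChar k l.parts * spChar k m.parts =
    ∑ᶠ (ν : Partn) (_ : ν.weight ≤ l.weight + m.weight),
      ((nl l m ν : ℤ) : RatFn k) * spChar k ν.parts := by
  obtain ⟨a, ha⟩ : ∃ a, a = l.weight := ⟨_, rfl⟩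
  obtain ⟨b, rfl⟩ : ∃ b, k = a + b := ⟨k - a, by omega⟩
  have ll : l.LengthLE a := len_mono (len_weight l) (by omega)
  have lm : m.LengthLE b := len_mono (len_weight m) (by omega)
  have dl := degree_ex a l ll
  have dm := degree_ex b m lm
  set D := (ex a l).degree + (ex b m).degree + tri (a + b) with hD
  rw [spChar_eq, spChar_eq, stab_le (Nat.le_add_right a b) _ _ cc_Hx l ll,
    stab_le (Nat.le_add_left b a) _ _ cc_Hx m lm, prod1 a b _ l m D le_rfl]
  rw [finsum_eq_sum_of_support_subset (s := PP (a + b) D)]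
  · refine Finset.sum_congr rfl fun ν hν => ?_
    rw [mem_PP] at hν
    rw [← spChar_eq, kZ_nl a b (by omega) l m ν (by omega) (by omega) hν.1]
    by_cases h : ν.weight ≤ l.weight + m.weight
    · rw [finsum_eq_if, if_pos h, mul_comm]
    · rw [finsum_eq_if, if_neg h, nl_zero l m ν (by omega)]; simp
  · intro ν hν
    by_cases h : ν.weight ≤ l.weight + m.weight
    · exact mem_PP_of ν (by omega) (by omega)
    · exact absurd (by beta_reduce; rw [finsum_eq_if, if_neg h]) hν

end NL

theorem newell_littlewood_sp (l m : Partn) (k : ℕ) (hk : l.weight + m.weight ≤ k) :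
    spChar k l.parts * spChar k m.parts =
    ∑ᶠ (ν : Partn) (_ : ν.weight ≤ l.weight + m.weight),
      (((∑ᶠ (σ : Partn) (α : Partn) (β : Partn),
          lrCoeff σ α l * lrCoeff σ β m * lrCoeff α β ν) : ℤ) : RatFn k) *
        spChar k ν.parts := by
  rcases le_total l.weight m.weight with h | h
  · exact NL.main_le l m k hk h
  · have := NL.main_le m l k (by omega) h
    rw [mul_comm, this, add_comm m.weight]
    simp only [NL.nl_comm m l]
    rfl
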